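/- Assume the Trudinger–Moser property holds with some constant ω ∈ (0,π], that f satisfies hypotheses (H), and that f is odd (f(−t) = −f(t) for all t). Then the set of weak solutions u ∈ X of (1/(2π))⟨u,v⟩_X = ∫₀¹ f(u) v dx for all v ∈ X is infinite. -/

import Mathlib

open MeasureTheory Real Set Filter Topology

noncomputable section

/-- Integrand of the squared Gagliardo `H^{1/2}` seminorm on `ℝ`. -/
def gagKer (u : ℝ → ℝ) : ℝ × ℝ → ℝ :=
  fun p => (u p.1 - u p.2) ^ 2 / |p.1 - p.2| ^ 2

/-- Integrand of the Gagliardo inner product `⟨u,v⟩_X`. -/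
def innerKer (u v : ℝ → ℝ) : ℝ × ℝ → ℝ :=
  fun p => (u p.1 - u p.2) * (v p.1 - v p.2) / |p.1 - p.2| ^ 2

/-- `u ∈ H^{1/2}(ℝ)` : `u ∈ L²(ℝ)` with finite Gagliardo seminorm. -/
def memH (u : ℝ → ℝ) : Prop :=
  Measurable u ∧ Integrable (fun x => (u x) ^ 2) ∧ Integrable (gagKer u)

/-- Squared Gagliardo seminorm `[u]²`. -/
def gagSq (u : ℝ → ℝ) : ℝ := ∫ p : ℝ × ℝ, gagKer u p

/-- Gagliardo seminorm `[u]`, i.e. the norm `‖u‖_X`. -/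
def gagNorm (u : ℝ → ℝ) : ℝ := Real.sqrt (gagSq u)

/-- Inner product `⟨u, v⟩_X`. -/
def innerX (u v : ℝ → ℝ) : ℝ := ∫ p : ℝ × ℝ, innerKer u v p

/-- `u ∈ X` : `u ∈ H^{1/2}(ℝ)` and `u = 0` a.e. outside `(0,1)`. -/
def memX (u : ℝ → ℝ) : Prop :=
  memH u ∧ ∀ᵐ x : ℝ, x ∉ Ioo (0 : ℝ) 1 → u x = 0

/-- `λ₁ = inf {[u]² : u ∈ X, ‖u‖_{L²(0,1)} = 1}`. -/
def lam1 : ℝ :=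
  sInf { t : ℝ | ∃ u : ℝ → ℝ, memX u ∧ (∫ x in Ioo (0 : ℝ) 1, (u x) ^ 2) = 1 ∧ gagSq u = t }

/-- Trudinger–Moser property with constant `ω`. -/
def TMprop (ω : ℝ) : Prop :=
  ∀ α : ℝ, 0 < α → α < 2 * π * ω →
    ∃ K : ℝ, 0 < K ∧ ∀ u : ℝ → ℝ, memX u → gagNorm u ≤ 1 →
      (∫⁻ x in Ioo (0 : ℝ) 1, ENNReal.ofReal (exp (α * (u x) ^ 2))) ≤ ENNReal.ofReal K

/-- The primitive `F(t) = ∫₀ᵗ f(τ) dτ`. -/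
def primF (f : ℝ → ℝ) : ℝ → ℝ := fun t => ∫ τ in (0 : ℝ)..t, f τ

/-- Hypotheses (H). -/
def HypH (f : ℝ → ℝ) : Prop :=
  Continuous f ∧ f 0 = 0 ∧
  (∃ t₀ > (0 : ℝ), ∃ M > (0 : ℝ),
    ∀ t : ℝ, t₀ ≤ |t| → 0 < primF f t ∧ primF f t ≤ M * |f t|) ∧
  (∀ t : ℝ, t ≠ 0 → 0 < 2 * primF f t ∧ 2 * primF f t ≤ f t * t) ∧
  (Filter.limsup (fun t => primF f t / t ^ 2) (𝓝[≠] (0 : ℝ)) < lam1 / (4 * π)) ∧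
  (∀ α : ℝ, 0 < α →
    Filter.Tendsto (fun t => |f t| * exp (-α * t ^ 2)) (Filter.cocompact ℝ) (𝓝 0))

/-- Hypotheses (H') with Trudinger–Moser constant `ω`. -/
def HypH' (f : ℝ → ℝ) (ω : ℝ) : Prop :=
  Continuous f ∧ f 0 = 0 ∧
  (∃ t₀ > (0 : ℝ), ∃ M > (0 : ℝ),
    ∀ t : ℝ, t₀ ≤ |t| → 0 < primF f t ∧ primF f t ≤ M * |f t|) ∧
  (∀ t : ℝ, t ≠ 0 → 0 < 2 * primF f t ∧ 2 * primF f t ≤ f t * t) ∧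
  (Filter.limsup (fun t => primF f t / t ^ 2) (𝓝[≠] (0 : ℝ)) < lam1 / (4 * π)) ∧
  ∃ α₀ : ℝ, 0 < α₀ ∧ α₀ < 2 * π * ω ∧
    (∀ α : ℝ, 0 < α → α < α₀ →
      Filter.Tendsto (fun t => |f t| * exp (-α * t ^ 2)) (Filter.cocompact ℝ) Filter.atTop) ∧
    (∀ α : ℝ, α₀ < α →
      Filter.Tendsto (fun t => |f t| * exp (-α * t ^ 2)) (Filter.cocompact ℝ) (𝓝 0)) ∧
    ∃ ψ : ℝ → ℝ, memX ψ ∧ gagNorm ψ = 1 ∧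
      ∃ b : ℝ, b < ω / (2 * α₀) ∧ ∀ t : ℝ, 0 < t →
        t ^ 2 / (4 * π) - (∫ x in Ioo (0 : ℝ) 1, primF f (t * ψ x)) ≤ b

/-- `u` is a (weak) solution of `(-Δ)^{1/2} u = f(u)` in `(0,1)`, `u = 0` outside. -/
def IsWeakSolution (f u : ℝ → ℝ) : Prop :=
  memX u ∧ ∀ v : ℝ → ℝ, memX v →
    IntegrableOn (fun x => f (u x) * v x) (Ioo (0 : ℝ) 1) ∧
    innerX u v / (2 * π) = ∫ x in Ioo (0 : ℝ) 1, f (u x) * v x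

/-- The energy functional `φ(u) = ‖u‖_X²/(4π) - ∫₀¹ F(u) dx`. -/
def phi (f u : ℝ → ℝ) : ℝ :=
  gagSq u / (4 * π) - ∫ x in Ioo (0 : ℝ) 1, primF f (u x)

/-- `⟨φ'(u), v⟩ = (1/(2π))⟨u,v⟩_X - ∫₀¹ f(u) v dx`. -/
def phiDeriv (f u v : ℝ → ℝ) : ℝ :=
  innerX u v / (2 * π) - ∫ x in Ioo (0 : ℝ) 1, f (u x) * v x

/-- The Palais–Smale condition at level `c`. -/
def PalaisSmaleAt (f : ℝ → ℝ) (c : ℝ) : Prop :=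
  ∀ u : ℕ → ℝ → ℝ, (∀ n, memX (u n)) →
    Filter.Tendsto (fun n => phi f (u n)) Filter.atTop (𝓝 c) →
    (∃ ε : ℕ → ℝ, Filter.Tendsto ε Filter.atTop (𝓝 0) ∧
      ∀ n, ∀ v : ℝ → ℝ, memX v → gagNorm v ≤ 1 → |phiDeriv f (u n) v| ≤ ε n) →
    ∃ w : ℝ → ℝ, memX w ∧ ∃ g : ℕ → ℕ, StrictMono g ∧
      Filter.Tendsto (fun k => gagNorm (fun x => u (g k) x - w x)) Filter.atTop (𝓝 0)

namespace BU

variable {E : Type*} [DecidableEq E]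

abbrev Ch (E : Type*) := Multiset E →₀ ZMod 2

def bdm (s : Multiset E) : Ch E := (s.map fun x => Finsupp.single (s.erase x) 1).sum
def bd : Ch E →ₗ[ZMod 2] Ch E := Finsupp.linearCombination (ZMod 2) bdm
def cn (a : E) : Ch E →ₗ[ZMod 2] Ch E := Finsupp.lmapDomain (ZMod 2) (ZMod 2) (Multiset.cons a)

lemma ch_add_self (c : Ch E) : c + c = 0 := by
  ext s; simp [CharTwo.add_self_eq_zero]

@[simp] lemma bd_single (s : Multiset E) : bd (Finsupp.single s 1) = bdm s := by
  simp [bd]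
@[simp] lemma cn_single (a : E) (s : Multiset E) :
    cn a (Finsupp.single s 1) = Finsupp.single (a ::ₘ s) 1 := by
  simp [cn]

lemma bdm_cons (a : E) (s : Multiset E) :
    bdm (a ::ₘ s) = Finsupp.single s 1 + cn a (bdm s) := by
  unfold bdm
  rw [Multiset.map_cons, Multiset.sum_cons, Multiset.erase_cons_head, map_multiset_sum,
    Multiset.map_map]
  congr 2
  apply Multiset.map_congr rfl
  intro x hx
  simp [Multiset.erase_cons_tail_of_mem hx]

lemma ch_ind {M : Type*} [AddCommGroup M] [Module (ZMod 2) M] {f g : Ch E →ₗ[ZMod 2] M}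
    (h : ∀ s, f (Finsupp.single s 1) = g (Finsupp.single s 1)) (c : Ch E) : f c = g c := by
  have : f = g := by
    apply Finsupp.lhom_ext'
    intro s
    ext
    simpa using h s
  rw [this]

lemma bd_cn (a : E) (c : Ch E) : bd (cn a c) = c + cn a (bd c) := by
  have := ch_ind (f := bd ∘ₗ cn a) (g := LinearMap.id + cn a ∘ₗ bd)
    (by intro s; simp [bdm_cons]) c
  simpa using this

lemma bd_bdm (s : Multiset E) : bd (bdm s) = 0 := by
  induction s using Multiset.induction_on with
  | empty => simp [bdm]
  | cons a s ih =>
    rw [bdm_cons, map_add, bd_cn, ih, map_zero, add_zero, bd_single, ch_add_self]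

lemma bd_bd (c : Ch E) : bd (bd c) = 0 := by
  have := ch_ind (f := bd ∘ₗ bd) (g := 0) (by intro s; simp [bd_bdm]) c
  simpa using this

def S (b : Multiset E → E) : ℕ → (Ch E →ₗ[ZMod 2] Ch E)
  | 0 => LinearMap.id
  | k+1 => Finsupp.linearCombination (ZMod 2) (fun s => cn (b s) (S b k (bdm s)))

@[simp] lemma S_succ_single (b : Multiset E → E) (k : ℕ) (s : Multiset E) :
    S b (k+1) (Finsupp.single s 1) = cn (b s) (S b k (bdm s)) := by
  simp [S]

lemma bd_S (b : Multiset E → E) (k : ℕ) (c : Ch E) : bd (S b (k+1) c) = S b k (bd c) := by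
  induction k generalizing c with
  | zero =>
    have := ch_ind (f := bd ∘ₗ S b 1) (g := bd)
      (by intro s; simp [bd_cn, S, bd_bdm]) c
    simpa [S] using this
  | succ k ih =>
    have := ch_ind (f := bd ∘ₗ S b (k+1+1)) (g := S b (k+1) ∘ₗ bd)
      (by intro s; simp [bd_cn, ih, bd_bdm]) c
    simpa using this

section neg
variable [AddCommGroup E]

def nu : Ch E →ₗ[ZMod 2] Ch E := Finsupp.lmapDomain (ZMod 2) (ZMod 2) (Multiset.map Neg.neg)

@[simp] lemma nu_single (s : Multiset E) :
    nu (Finsupp.single s 1) = Finsupp.single (s.map Neg.neg) 1 := by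
  simp [nu]

lemma nu_cn (a : E) (c : Ch E) : nu (cn a c) = cn (-a) (nu c) := by
  have := ch_ind (f := nu ∘ₗ cn a) (g := cn (-a) ∘ₗ nu) (by intro s; simp) c
  simpa using this

lemma nu_bdm (s : Multiset E) : nu (bdm s) = bdm (s.map Neg.neg) := by
  induction s using Multiset.induction_on with
  | empty => simp [bdm]
  | cons a s ih => simp [bdm_cons, nu_cn, ih]

lemma nu_nu (c : Ch E) : nu (nu c) = c := by
  have := ch_ind (f := nu ∘ₗ nu) (g := LinearMap.id) (by intro s; simp) c
  simpa using this

lemma nu_S (b : Multiset E → E) (hb : ∀ s, b (s.map Neg.neg) = - b s) (k : ℕ) (c : Ch E) :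
    nu (S b k c) = S b k (nu c) := by
  induction k generalizing c with
  | zero => simp [S]
  | succ k ih =>
    have := ch_ind (f := nu ∘ₗ S b (k+1)) (g := S b (k+1) ∘ₗ nu)
      (by intro s; simp [nu_cn, ih, nu_bdm, hb]) c
    simpa using this

/-- full cross-polytope chains -/
def dch (e : ℕ → E) : ℕ → Ch E
  | 0 => Finsupp.single 0 1
  | k+1 => cn (e k) (dch e k) + cn (- e k) (dch e k)

lemma nu_dch (e : ℕ → E) (k : ℕ) : nu (dch e k) = dch e k := by
  induction k with
  | zero => simp [dch]
  | succ k ih => simp [dch, nu_cn, ih, add_comm]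

lemma bd_dch (e : ℕ → E) (k : ℕ) : bd (dch e k) = 0 := by
  induction k with
  | zero => simp [dch, bdm]
  | succ k ih => simp [dch, bd_cn, ih, ch_add_self]

def cch (e : ℕ → E) (k : ℕ) : Ch E := cn (e k) (dch e k)

lemma bd_cch_zero (e : ℕ → E) : bd (cch e 0) = Finsupp.single 0 1 := by
  simp [cch, bd_cn, bd_dch, dch, bdm]

lemma bd_cch_succ (e : ℕ → E) (k : ℕ) : bd (cch e (k+1)) = cch e k + nu (cch e k) := by
  simp [cch, bd_cn, bd_dch, nu_cn, nu_dch]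
  simp [dch]

lemma bd_sub (b : Multiset E → E) (m k : ℕ) (c : Ch E) :
    bd ((S b (k+1))^[m] c) = (S b k)^[m] (bd c) := by
  induction m generalizing c with
  | zero => simp
  | succ m ih => simp only [Function.iterate_succ, Function.comp]; rw [ih, bd_S]

lemma nu_sub (b : Multiset E → E) (hb : ∀ s, b (s.map Neg.neg) = - b s) (m k : ℕ) (c : Ch E) :
    nu ((S b k)^[m] c) = (S b k)^[m] (nu c) := by
  induction m generalizing c with
  | zero => simp
  | succ m ih => simp only [Function.iterate_succ, Function.comp]; rw [ih, nu_S b hb]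

lemma it_add (b : Multiset E → E) (m k : ℕ) (c d : Ch E) :
    (S b k)^[m] (c + d) = (S b k)^[m] c + (S b k)^[m] d := by
  induction m generalizing c d with
  | zero => simp
  | succ m ih => simp only [Function.iterate_succ, Function.comp]; rw [map_add, ih]

end neg

/-! the Fan cochain -/
def pl : ℕ → Multiset ℤ → ZMod 2
  | 0, l => if l = 0 then 1 else 0
  | N+1, l =>
    if l.count ((N:ℤ)+1) + l.count (-((N:ℤ)+1)) = 0 then pl N l
    else if l.count ((N:ℤ)+1) + l.count (-((N:ℤ)+1)) = 1 ∧
        l.count ((-1)^(l.card+1) * ((N:ℤ)+1)) = 1 then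
      pl N (l.filter (fun x => x ≠ (N:ℤ)+1 ∧ x ≠ -((N:ℤ)+1)))
    else 0

def Dp (p : Multiset ℤ → ZMod 2) (l : Multiset ℤ) : ZMod 2 := (l.map fun x => p (l.erase x)).sum

lemma Dp_cons (p : Multiset ℤ → ZMod 2) (a : ℤ) (s : Multiset ℤ) :
    Dp p (a ::ₘ s) = p s + Dp (fun t => p (a ::ₘ t)) s := by
  unfold Dp
  rw [Multiset.map_cons, Multiset.sum_cons, Multiset.erase_cons_head]
  congr 2
  apply Multiset.map_congr rfl
  intro x hx
  simp [Multiset.erase_cons_tail_of_mem hx]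

lemma Dp_congr {p q : Multiset ℤ → ZMod 2} {l : Multiset ℤ}
    (h : ∀ t, t ≤ l → t.card + 1 = l.card → p t = q t) :
    Dp p l = Dp q l := by
  unfold Dp
  congr 1
  apply Multiset.map_congr rfl
  intro x hx
  refine h _ (Multiset.erase_le _ _) ?_
  rw [Multiset.card_erase_add_one hx]

lemma pl_big (N : ℕ) (l : Multiset ℤ) (h : N < l.card) : pl N l = 0 := by
  induction N generalizing l with
  | zero => 
    have : l ≠ 0 := by rintro rfl; simp at h
    simp [pl, this]
  | succ N ih =>
    rw [pl]
    split_ifs with h1 h2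
    · exact ih _ (by omega)
    · apply ih
      have h3 : l.card = (l.filter (fun x => x ≠ (N:ℤ)+1 ∧ x ≠ -((N:ℤ)+1))).card
          + (l.filter (fun x => ¬ (x ≠ (N:ℤ)+1 ∧ x ≠ -((N:ℤ)+1)))).card := by
        rw [← Multiset.card_add, Multiset.filter_add_not]
      have h4 : (l.filter (fun x => ¬ (x ≠ (N:ℤ)+1 ∧ x ≠ -((N:ℤ)+1)))).card ≤
          l.count ((N:ℤ)+1) + l.count (-((N:ℤ)+1)) := by
        clear h h1 h2 h3
        induction l using Multiset.induction_on with
        | empty => simp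
        | cons a s ihs =>
          have hne : (N:ℤ)+1 ≠ -((N:ℤ)+1) := by omega
          generalize (N:ℤ)+1 = A at *
          generalize -A = B at *
          by_cases hA : a = A
          · subst hA
            rw [Multiset.filter_cons_of_pos _ (by simp), Multiset.count_cons_self,
              Multiset.count_cons_of_ne hne.symm, Multiset.card_cons]
            omega
          · by_cases hB : a = B
            · subst hB
              rw [Multiset.filter_cons_of_pos _ (by simp), Multiset.count_cons_self,
                Multiset.count_cons_of_ne hne, Multiset.card_cons]
              omega
            · rw [Multiset.filter_cons_of_neg _ (by simp [hA, hB]),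
                Multiset.count_cons_of_ne (Ne.symm hA), Multiset.count_cons_of_ne (Ne.symm hB)]
              omega
      omega
    · rfl

lemma count_zero_of_le {a : ℤ} {s t : Multiset ℤ} (h : t ≤ s) (h0 : s.count a = 0) :
    t.count a = 0 := Nat.le_zero.1 (h0 ▸ Multiset.count_le_of_le a h)

/-- one top label -/
lemma pl_cons_one (N : ℕ) (a : ℤ) (ha : a = (N:ℤ)+1 ∨ a = -((N:ℤ)+1)) (t : Multiset ℤ)
    (h1 : t.count ((N:ℤ)+1) = 0) (h2 : t.count (-((N:ℤ)+1)) = 0) :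
    pl (N+1) (a ::ₘ t) = if a = (-1)^(t.card) * ((N:ℤ)+1) then pl N t else 0 := by
  have hne : (N:ℤ)+1 ≠ -((N:ℤ)+1) := by omega
  have hf : (a ::ₘ t).filter (fun x => x ≠ (N:ℤ)+1 ∧ x ≠ -((N:ℤ)+1)) = t := by
    rw [Multiset.filter_cons_of_neg _ (by tauto), Multiset.filter_eq_self]
    intro x hx
    rw [Multiset.count_eq_zero] at h1 h2
    constructor <;> rintro rfl <;> contradiction
  have hs : ((-1:ℤ)^(t.card)) = 1 ∨ ((-1:ℤ)^(t.card)) = -1 := neg_one_pow_eq_or ℤ _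
  rw [pl, hf]
  have e : (-1:ℤ)^((a ::ₘ t).card+1) = (-1)^(t.card) := by
    rw [Multiset.card_cons, pow_succ, pow_succ]; ring
  rw [e]
  simp only [Multiset.count_cons, h1, h2]
  clear hf e
  rcases hs with hs | hs <;> rw [hs]
  · rw [one_mul]
    generalize (N:ℤ)+1 = A at *
    generalize -A = B at *
    rcases ha with rfl | rfl <;> simp [hne, hne.symm, h1, h2]
  · rw [neg_one_mul]
    generalize (N:ℤ)+1 = A at *
    generalize -A = B at *
    rcases ha with rfl | rfl <;> simp [hne, hne.symm, h1, h2]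

lemma pl_none (N : ℕ) (t : Multiset ℤ)
    (h1 : t.count ((N:ℤ)+1) = 0) (h2 : t.count (-((N:ℤ)+1)) = 0) :
    pl (N+1) t = pl N t := by
  rw [pl, h1, h2]; simp

lemma pl_two (N : ℕ) (a : ℤ) (ha : a = (N:ℤ)+1 ∨ a = -((N:ℤ)+1)) (t : Multiset ℤ) :
    pl (N+1) (a ::ₘ a ::ₘ t) = 0 := by
  have hne : (N:ℤ)+1 ≠ -((N:ℤ)+1) := by omega
  rw [pl]
  simp only [Multiset.count_cons]
  rcases ha with rfl | rfl <;> simp [hne, hne.symm] <;> omega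

lemma count_neg (t : Multiset ℤ) (a : ℤ) : (t.map Neg.neg).count a = t.count (-a) := by
  have := Multiset.count_map_eq_count' (Neg.neg : ℤ → ℤ) t neg_injective (-a)
  simpa using this

lemma Dp_zero (l : Multiset ℤ) : Dp (fun _ => 0) l = 0 := by simp [Dp]

lemma fan (N : ℕ) (l : Multiset ℤ) (hb : ∀ x ∈ l, x ≠ 0 ∧ |x| ≤ N)
    (hl : ∀ x ∈ l, -x ∉ l) : Dp (pl N) l = pl N l + pl N (l.map Neg.neg) := by
  induction N generalizing l with
  | zero =>
    have : l = 0 := by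
      apply Multiset.eq_zero_of_forall_notMem
      intro x hx
      have := hb x hx
      have h2 := abs_pos.2 this.1
      push_cast at this; omega
    subst this
    simp [Dp, pl, CharTwo.add_self_eq_zero]
  | succ N ih =>
    have hne : (N:ℤ)+1 ≠ -((N:ℤ)+1) := by omega
    by_cases h0 : ∃ a ∈ l, a = (N:ℤ)+1 ∨ a = -((N:ℤ)+1)
    · obtain ⟨a, hal, ha⟩ := h0
      obtain ⟨l', rfl⟩ := Multiset.exists_cons_of_mem hal
      have hna : -a ∉ l' := fun h => hl a hal (Multiset.mem_cons_of_mem h)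
      have ha' : -a = (N:ℤ)+1 ∨ -a = -((N:ℤ)+1) := by
        rcases ha with rfl | rfl <;> simp
      by_cases h1 : a ∈ l'
      · obtain ⟨l'', rfl⟩ := Multiset.exists_cons_of_mem h1
        rw [pl_two N a ha, Multiset.map_cons, Multiset.map_cons, pl_two N (-a) ha', Dp_cons,
          Dp_cons]
        have : (fun t => pl (N+1) (a ::ₘ a ::ₘ t)) = fun _ => 0 := by
          funext t; exact pl_two N a ha t
        rw [this, Dp_zero, add_zero, add_zero, CharTwo.add_self_eq_zero]
      · have c1 : l'.count ((N:ℤ)+1) = 0 := by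
          rw [Multiset.count_eq_zero]; rcases ha with rfl | rfl <;> simp_all
        have c2 : l'.count (-((N:ℤ)+1)) = 0 := by
          rw [Multiset.count_eq_zero]; rcases ha with rfl | rfl <;> simp_all
        have hb' : ∀ x ∈ l', x ≠ 0 ∧ |x| ≤ N := by
          intro x hx
          obtain ⟨p, q⟩ := hb x (Multiset.mem_cons_of_mem hx)
          refine ⟨p, ?_⟩
          rw [Multiset.count_eq_zero] at c1 c2
          have : x ≠ (N:ℤ)+1 := by rintro rfl; exact c1 hx
          have : x ≠ -((N:ℤ)+1) := by rintro rfl; exact c2 hx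
          push_cast at q
          rw [abs_le] at q ⊢
          omega
        have ihl := ih l' hb'
          (fun x hx h => hl x (Multiset.mem_cons_of_mem hx) (Multiset.mem_cons_of_mem h))
        rw [Dp_cons, pl_none N l' c1 c2, pl_cons_one N a ha l' c1 c2, Multiset.map_cons,
          pl_cons_one N (-a) ha' (l'.map Neg.neg) (by rw [count_neg]; exact c2)
            (by rw [count_neg, neg_neg]; exact c1), Multiset.card_map]
        have hs : ((-1:ℤ)^(l'.card)) = 1 ∨ ((-1:ℤ)^(l'.card)) = -1 := neg_one_pow_eq_or ℤ _
        by_cases hc : a = (-1)^(l'.card) * ((N:ℤ)+1)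
        · have hc' : ¬ (-a = (-1)^(l'.card) * ((N:ℤ)+1)) := by
            rcases hs with hs | hs <;> rw [hs] at hc ⊢ <;> omega
          rw [if_pos hc, if_neg hc', add_zero]
          have : Dp (fun t => pl (N+1) (a ::ₘ t)) l' = Dp (fun _ => 0) l' := by
            apply Dp_congr
            intro t ht hcard
            rw [pl_cons_one N a ha t (count_zero_of_le ht c1) (count_zero_of_le ht c2), if_neg]
            intro hc2
            rw [← hcard, pow_succ] at hc
            have : ((-1:ℤ)^(t.card)) = 1 ∨ ((-1:ℤ)^(t.card)) = -1 := neg_one_pow_eq_or ℤ _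
            rcases this with hs | hs <;> rw [hs] at hc hc2 <;> omega
          rw [this, Dp_zero, add_zero]
        · have hc' : -a = (-1)^(l'.card) * ((N:ℤ)+1) := by
            rcases hs with hs | hs <;> rw [hs] at hc ⊢ <;> omega
          rw [if_neg hc, if_pos hc', zero_add]
          have : Dp (fun t => pl (N+1) (a ::ₘ t)) l' = Dp (pl N) l' := by
            apply Dp_congr
            intro t ht hcard
            rw [pl_cons_one N a ha t (count_zero_of_le ht c1) (count_zero_of_le ht c2), if_pos]
            rw [← hcard, pow_succ] at hc'
            linarith
          rw [this, ihl, ← add_assoc, CharTwo.add_self_eq_zero, zero_add]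
    · have c1 : l.count ((N:ℤ)+1) = 0 := by
        rw [Multiset.count_eq_zero]; intro h; exact h0 ⟨_, h, Or.inl rfl⟩
      have c2 : l.count (-((N:ℤ)+1)) = 0 := by
        rw [Multiset.count_eq_zero]; intro h; exact h0 ⟨_, h, Or.inr rfl⟩
      have hb' : ∀ x ∈ l, x ≠ 0 ∧ |x| ≤ N := by
        intro x hx
        obtain ⟨p, q⟩ := hb x hx
        refine ⟨p, ?_⟩
        have : x ≠ (N:ℤ)+1 := by rintro rfl; exact h0 ⟨_, hx, Or.inl rfl⟩
        have : x ≠ -((N:ℤ)+1) := by rintro rfl; exact h0 ⟨_, hx, Or.inr rfl⟩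
        push_cast at q
        rw [abs_le] at q ⊢
        omega
      rw [pl_none N l c1 c2, pl_none N (l.map Neg.neg) (by rw [count_neg]; exact c2)
            (by rw [count_neg, neg_neg]; exact c1), ← ih l hb' hl]
      apply Dp_congr
      intro t ht _
      exact pl_none N t (count_zero_of_le ht c1) (count_zero_of_le ht c2)

end BU

namespace BU

def supp {E : Type*} (P : Multiset E → Prop) : Submodule (ZMod 2) (Ch E) :=
  Finsupp.supported (ZMod 2) (ZMod 2) {s | P s}

section
variable {E : Type*} [DecidableEq E]

lemma single_supp {P : Multiset E → Prop} {s : Multiset E} (h : P s) :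
    (Finsupp.single s 1 : Ch E) ∈ supp P :=
  Finsupp.single_mem_supported _ _ h

lemma supp_map {M : Type*} [AddCommGroup M] [Module (ZMod 2) M] {P : Multiset E → Prop}
    (f : Ch E →ₗ[ZMod 2] M) (Q : Submodule (ZMod 2) M)
    (h : ∀ s, P s → f (Finsupp.single s 1) ∈ Q) {c : Ch E} (hc : c ∈ supp P) :
    f c ∈ Q := by
  have : supp P ≤ Q.comap f := by
    unfold supp
    rw [Finsupp.supported_eq_span_single, Submodule.span_le]
    rintro _ ⟨s, hs, rfl⟩
    exact h s hs
  exact this hc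

lemma supp_cn {P Q : Multiset E → Prop} (a : E) (h : ∀ t, P t → Q (a ::ₘ t)) {c : Ch E}
    (hc : c ∈ supp P) : cn a c ∈ supp Q :=
  supp_map _ _ (fun s hs => by rw [cn_single]; exact single_supp (h s hs)) hc

lemma supp_mono {P Q : Multiset E → Prop} (h : ∀ t, P t → Q t) {c : Ch E}
    (hc : c ∈ supp P) : c ∈ supp Q :=
  Finsupp.supported_mono (fun t ht => h t ht) hc

variable [NormedAddCommGroup E] [NormedSpace ℝ E]

def bary (s : Multiset E) : E := ((s.card : ℝ))⁻¹ • s.sum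

lemma bary_neg (s : Multiset E) : bary (s.map Neg.neg) = - bary s := by
  simp [bary, Multiset.sum_map_neg']

lemma bary_mem {K : Set E} (hK : Convex ℝ K) {s : Multiset E} (hs : 0 < s.card)
    (h : ∀ x ∈ s, x ∈ K) : bary s ∈ K := by
  have key : ∀ s : Multiset E, (∀ x ∈ s, x ∈ K) → 0 < s.card → bary s ∈ K := by
    intro s
    induction s using Multiset.induction_on with
    | empty => simp
    | cons a s ih =>
      intro h _
      by_cases h0 : s = 0
      · subst h0; simpa [bary] using h
      · have hc : 0 < s.card := Multiset.card_pos.2 h0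
        have h1 := ih (fun x hx => h x (Multiset.mem_cons_of_mem hx)) hc
        have h2 := h a (Multiset.mem_cons_self _ _)
        have hc' : (0:ℝ) < s.card := by exact_mod_cast hc
        have := hK h2 h1 (a := ((s.card:ℝ)+1)⁻¹) (b := s.card * ((s.card:ℝ)+1)⁻¹)
          (by positivity) (by positivity) (by field_simp; ring)
        convert this using 1
        unfold bary
        rw [Multiset.card_cons, Multiset.sum_cons, smul_add, smul_smul]
        push_cast
        congr 2
        field_simp
  exact key s h hs

lemma bary_dist {s : Multiset E} {r : ℝ} (hr : 0 ≤ r) (h : ∀ x ∈ s, ∀ y ∈ s, dist x y ≤ r)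
    {y : E} (hy : y ∈ s) : dist y (bary s) ≤ (1 - (s.card:ℝ)⁻¹) * r := by
  obtain ⟨t, rfl⟩ := Multiset.exists_cons_of_mem hy
  by_cases h0 : t = 0
  · subst h0; simp [bary]
  have hc : 0 < t.card := Multiset.card_pos.2 h0
  have hc' : (0:ℝ) < t.card := by exact_mod_cast hc
  have h1 : bary t ∈ Metric.closedBall y r :=
    bary_mem (convex_closedBall y r) hc (fun x hx => by
      rw [Metric.mem_closedBall]
      exact h x (Multiset.mem_cons_of_mem hx) y hy)
  have h2 : y - bary (y ::ₘ t) = (1 - ((y ::ₘ t).card:ℝ)⁻¹) • (y - bary t) := by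
    unfold bary
    rw [Multiset.card_cons, Multiset.sum_cons]
    push_cast
    have e1 : (1 - ((t.card:ℝ)+1)⁻¹) = t.card * ((t.card:ℝ)+1)⁻¹ := by field_simp; ring
    rw [smul_sub, smul_smul]
    have e2 : (1 - ((t.card:ℝ)+1)⁻¹) * (t.card:ℝ)⁻¹ = ((t.card:ℝ)+1)⁻¹ := by
      rw [e1]; field_simp
    rw [e2, sub_smul, one_smul, smul_add]
    abel
  have hle : (0:ℝ) ≤ 1 - ((y ::ₘ t).card:ℝ)⁻¹ := by
    rw [Multiset.card_cons]; push_cast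
    rw [sub_nonneg]
    exact inv_le_one_of_one_le₀ (by linarith)
  rw [dist_eq_norm, h2, norm_smul, Real.norm_of_nonneg hle]
  rw [Metric.mem_closedBall, dist_comm, dist_eq_norm] at h1
  exact mul_le_mul_of_nonneg_left h1 hle

def Qr (c : ℝ) (s t : Multiset E) : Prop :=
  t.card = s.card ∧ (∀ K : Set E, Convex ℝ K → (∀ x ∈ s, x ∈ K) → ∀ x ∈ t, x ∈ K) ∧
  ∀ r : ℝ, 0 ≤ r → (∀ x ∈ s, ∀ y ∈ s, dist x y ≤ r) → ∀ x ∈ t, ∀ y ∈ t, dist x y ≤ c * r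

lemma S_supp (n : ℕ) (k : ℕ) (hk : k ≤ n + 1) (s : Multiset E) (hs : s.card = k) :
    S bary k (Finsupp.single s 1) ∈ supp (Qr (1 - ((n:ℝ)+1)⁻¹) s) := by
  induction k generalizing s with
  | zero =>
    have : s = 0 := Multiset.card_eq_zero.1 hs
    subst this
    simp only [S, LinearMap.id_coe, id_eq]
    apply single_supp
    refine ⟨rfl, ?_, ?_⟩ <;> simp
  | succ k ih =>
    rw [S_succ_single]
    have hn : (0:ℝ) < (n:ℝ) + 1 := by positivity
    have hc0 : (0:ℝ) ≤ 1 - ((n:ℝ)+1)⁻¹ := by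
      rw [sub_nonneg]; exact inv_le_one_of_one_le₀ (by linarith [Nat.cast_nonneg (α := ℝ) n])
    -- bound on faces
    have hface : S bary k (bdm s) ∈ supp (fun t => ∃ x ∈ s, Qr (1 - ((n:ℝ)+1)⁻¹) (s.erase x) t) := by
      unfold bdm
      rw [map_multiset_sum, Multiset.map_map]
      apply multiset_sum_mem
      intro c hc
      rw [Multiset.mem_map] at hc
      obtain ⟨x, hx, rfl⟩ := hc
      refine supp_mono ?_ (ih (by omega) (s.erase x) (by rw [Multiset.card_erase_of_mem hx, hs]; rfl))
      exact fun t ht => ⟨x, hx, ht⟩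
    refine supp_cn _ ?_ hface
    rintro t ⟨z, hz, h1, h2, h3⟩
    have hsub : ∀ x ∈ s.erase z, x ∈ s := fun x hx => Multiset.mem_of_mem_erase hx
    refine ⟨?_, ?_, ?_⟩
    · rw [Multiset.card_cons, h1, Multiset.card_erase_add_one hz]
    · intro K hK hsK x hx
      rcases Multiset.mem_cons.1 hx with rfl | hx
      · exact bary_mem hK (by omega) hsK
      · exact h2 K hK (fun x hx => hsK x (hsub x hx)) x hx
    · intro r hr hsr
      have hb : ∀ y ∈ t, dist y (bary s) ≤ (1 - ((n:ℝ)+1)⁻¹) * r := by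
        intro y hy
        have := h2 (Metric.closedBall (bary s) ((1 - ((n:ℝ)+1)⁻¹) * r)) (convex_closedBall _ _)
          (fun x hx => by
            rw [Metric.mem_closedBall]
            refine (bary_dist hr hsr (hsub x hx)).trans ?_
            refine mul_le_mul_of_nonneg_right ?_ hr
            rw [hs]
            apply sub_le_sub_left
            apply inv_anti₀
            · positivity
            · exact_mod_cast hk) y hy
        simpa using this
      intro x hx y hy
      rcases Multiset.mem_cons.1 hx with rfl | hx <;> rcases Multiset.mem_cons.1 hy with rfl | hy
      · rw [dist_self]; positivity
      · rw [dist_comm]; exact hb y hy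
      · exact hb x hx
      · exact h3 r hr (fun x hx y hy => hsr x (hsub x hx) y (hsub y hy)) x hx y hy

def Gd (F : Set (Set E)) (k : ℕ) (r : ℝ) (t : Multiset E) : Prop :=
  t.card = k ∧ (∃ K ∈ F, ∀ x ∈ t, x ∈ K) ∧ ∀ x ∈ t, ∀ y ∈ t, dist x y ≤ r

lemma S_iter (F : Set (Set E)) (hF : ∀ K ∈ F, Convex ℝ K) (n k : ℕ) (hk : k ≤ n+1) (m : ℕ) (r : ℝ)
    (hr : 0 ≤ r) (c : Ch E) (hc : c ∈ supp (Gd F k r)) :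
    (S bary k)^[m] c ∈ supp (Gd F k ((1 - ((n:ℝ)+1)⁻¹)^m * r)) := by
  induction m with
  | zero => simpa using hc
  | succ m ih =>
    have hc0 : (0:ℝ) ≤ 1 - ((n:ℝ)+1)⁻¹ := by
      rw [sub_nonneg]; exact inv_le_one_of_one_le₀ (by linarith [Nat.cast_nonneg (α := ℝ) n])
    rw [Function.iterate_succ_apply']
    refine supp_map _ _ ?_ ih
    rintro s ⟨h1, ⟨K, hKF, hK⟩, h3⟩
    refine supp_mono ?_ (S_supp n k hk s h1)
    rintro t ⟨q1, q2, q3⟩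
    refine ⟨q1.trans h1, ⟨K, hKF, q2 K (hF K hKF) hK⟩, ?_⟩
    intro x hx y hy
    have := q3 _ (by positivity) h3 x hx y hy
    rw [pow_succ]; linarith
end

def ebas (n : ℕ) (i : ℕ) : Fin (n+1) → ℝ := fun j => if (j:ℕ) = i then 1 else 0

def Oset (n : ℕ) (ε : ℕ → ℝ) : Set (Fin (n+1) → ℝ) :=
  {x | ∑ i : Fin (n+1), ε i * x i = 1 ∧ ∀ i : Fin (n+1), 0 ≤ ε i * x i}

lemma Oset_convex (n : ℕ) (ε : ℕ → ℝ) : Convex ℝ (Oset n ε) := by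
  rintro x ⟨hx, hx'⟩ y ⟨hy, hy'⟩ a b ha hb hab
  refine ⟨?_, ?_⟩
  · have : ∀ i : Fin (n+1), ε i * (a • x + b • y) i = a * (ε i * x i) + b * (ε i * y i) := by
      intro i; simp; ring
    simp_rw [this]
    rw [Finset.sum_add_distrib, ← Finset.mul_sum, ← Finset.mul_sum, hx, hy]; linarith
  · intro i
    have : ε i * (a • x + b • y) i = a * (ε i * x i) + b * (ε i * y i) := by
      simp; ring
    rw [this]
    have := hx' i; have := hy' i
    positivity

def Ofam (n : ℕ) : Set (Set (Fin (n+1) → ℝ)) :=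
  {K | ∃ ε : ℕ → ℝ, (∀ i, ε i = 1 ∨ ε i = -1) ∧ K = Oset n ε}

lemma Oset_abs {n : ℕ} {ε : ℕ → ℝ} (hε : ∀ i, ε i = 1 ∨ ε i = -1) {x : Fin (n+1) → ℝ}
    (hx : x ∈ Oset n ε) : ∑ i, |x i| = 1 := by
  rw [← hx.1]
  apply Finset.sum_congr rfl
  intro i _
  have := hx.2 i
  rcases hε i with h | h <;> rw [h] at this ⊢
  · rw [one_mul] at *; exact abs_of_nonneg this
  · rw [neg_one_mul] at *; exact abs_of_nonpos (by linarith)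

lemma ebas_mem {n : ℕ} {ε : ℕ → ℝ} (hε : ∀ i, ε i = 1 ∨ ε i = -1) {i : ℕ} (hi : i < n+1) :
    ε i • ebas n i ∈ Oset n ε := by
  have hsq : ∀ i, ε i * ε i = 1 := by
    intro i; rcases hε i with h | h <;> rw [h] <;> norm_num
  have : ∀ j : Fin (n+1), ε j * (ε i • ebas n i) j = if j = ⟨i, hi⟩ then 1 else 0 := by
    intro j
    by_cases hj : (j:ℕ) = i
    · have : j = ⟨i, hi⟩ := Fin.ext hj
      subst this
      simp [ebas, hsq]
    · have : j ≠ ⟨i, hi⟩ := fun h => hj (by rw [h])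
      simp [ebas, hj, this]
  refine ⟨?_, ?_⟩
  · simp_rw [this]; simp
  · intro j; rw [this]; split_ifs <;> norm_num

lemma dch_supp (n k : ℕ) : dch (ebas n) k ∈ supp (fun t => t.card = k ∧
    ∃ ε : ℕ → ℝ, (∀ i, ε i = 1 ∨ ε i = -1) ∧ ∀ x ∈ t, ∃ i < k, x = ε i • ebas n i) := by
  induction k with
  | zero =>
    apply single_supp
    refine ⟨rfl, fun _ => 1, fun _ => Or.inl rfl, by simp⟩
  | succ k ih =>
    have key : ∀ δ : ℝ, (δ = 1 ∨ δ = -1) → cn (δ • ebas n k) (dch (ebas n) k) ∈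
      supp (fun t => t.card = k + 1 ∧
        ∃ ε : ℕ → ℝ, (∀ i, ε i = 1 ∨ ε i = -1) ∧ ∀ x ∈ t, ∃ i < k + 1, x = ε i • ebas n i) := by
      intro δ hδ
      refine supp_cn _ ?_ ih
      rintro t ⟨h1, ε, h2, h3⟩
      refine ⟨by rw [Multiset.card_cons, h1], Function.update ε k δ, ?_, ?_⟩
      · intro i
        by_cases hi : i = k
        · subst hi; simpa using hδ
        · simpa [hi] using h2 i
      · intro x hx
        rcases Multiset.mem_cons.1 hx with rfl | hx
        · exact ⟨k, by omega, by simp⟩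
        · obtain ⟨i, hi, rfl⟩ := h3 x hx
          exact ⟨i, by omega, by rw [Function.update_of_ne (by omega)]⟩
    have h1 := key 1 (Or.inl rfl)
    have h2 := key (-1) (Or.inr rfl)
    rw [one_smul] at h1
    rw [neg_one_smul] at h2
    exact Submodule.add_mem _ h1 h2

lemma cch_supp (n k : ℕ) (hk : k ≤ n) : cch (ebas n) k ∈ supp (Gd (Ofam n) (k+1) 2) := by
  refine supp_cn _ ?_ (dch_supp n k)
  rintro t ⟨h1, ε, h2, h3⟩
  have key : ∀ x ∈ ebas n k ::ₘ t, x ∈ Oset n (Function.update ε k 1) := by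
    have hε : ∀ i, Function.update ε k 1 i = 1 ∨ Function.update ε k 1 i = -1 := by
      intro i
      by_cases hi : i = k
      · subst hi; simp
      · simpa [hi] using h2 i
    intro x hx
    rcases Multiset.mem_cons.1 hx with rfl | hx
    · have := ebas_mem hε (i := k) (n := n) (by omega)
      simpa using this
    · obtain ⟨i, hi, rfl⟩ := h3 x hx
      have := ebas_mem hε (i := i) (n := n) (by omega)
      rwa [Function.update_of_ne (by omega)] at this
  have hε : ∀ i, Function.update ε k 1 i = 1 ∨ Function.update ε k 1 i = -1 := by
    intro i
    by_cases hi : i = k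
    · subst hi; simp
    · simpa [hi] using h2 i
  refine ⟨by rw [Multiset.card_cons, h1], ⟨_, ⟨_, hε, rfl⟩, key⟩, ?_⟩
  have hn : ∀ x ∈ ebas n k ::ₘ t, ‖x‖ ≤ 1 := by
    intro x hx
    rw [pi_norm_le_iff_of_nonneg (by norm_num)]
    intro i
    rw [← Oset_abs hε (key x hx), Real.norm_eq_abs]
    exact Finset.single_le_sum (f := fun i => |x i|) (fun _ _ => abs_nonneg _) (Finset.mem_univ i)
  intro x hx y hy
  rw [dist_eq_norm]
  linarith [norm_sub_le x y, hn x hx, hn y hy]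

/-- evaluation of the Fan cochain along a labelling -/
def ev {E : Type*} (lab : E → ℤ) (N : ℕ) : Ch E →ₗ[ZMod 2] ZMod 2 :=
  Finsupp.linearCombination (ZMod 2) (fun s => pl N (s.map lab))

lemma ev_bdm {E : Type*} [DecidableEq E] (lab : E → ℤ) (N : ℕ) (s : Multiset E) :
    ev lab N (bdm s) = Dp (pl N) (s.map lab) := by
  unfold bdm Dp
  rw [map_multiset_sum, Multiset.map_map, Multiset.map_map]
  congr 1
  apply Multiset.map_congr rfl
  intro x hx
  simp [ev, Multiset.map_erase_of_mem _ _ hx]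

lemma ev_bd {E : Type*} [DecidableEq E] [AddCommGroup E] (lab : E → ℤ) (N : ℕ)
    (P : Multiset E → Prop)
    (h1 : ∀ s, P s → ∀ x ∈ s, lab x ≠ 0 ∧ |lab x| ≤ N)
    (h2 : ∀ s, P s → ∀ x ∈ s, ∀ y ∈ s, lab x ≠ - lab y)
    (h3 : ∀ s, P s → ∀ x ∈ s, lab (-x) = - lab x) (c : Ch E) (hc : c ∈ supp P) :
    ev lab N (bd c) = ev lab N c + ev lab N (nu c) := by
  have := supp_map (ev lab N ∘ₗ bd - (ev lab N + ev lab N ∘ₗ nu)) ⊥ (P := P) (c := c) ?_ hc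
  · rw [Submodule.mem_bot] at this
    simpa [sub_eq_zero] using this
  · intro s hs
    rw [Submodule.mem_bot, LinearMap.sub_apply, sub_eq_zero]
    simp only [LinearMap.comp_apply, LinearMap.add_apply, bd_single, nu_single]
    rw [ev_bdm, fan]
    · simp only [ev, Finsupp.linearCombination_single, one_smul, Multiset.map_map]
      congr 2
      apply Multiset.map_congr rfl
      intro x hx
      simp [h3 s hs x hx]
    · intro x hx
      rw [Multiset.mem_map] at hx
      obtain ⟨y, hy, rfl⟩ := hx
      exact h1 s hs y hy
    · intro x hx hx'
      rw [Multiset.mem_map] at hx hx'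
      obtain ⟨y, hy, rfl⟩ := hx
      obtain ⟨z, hz, h⟩ := hx'
      exact h2 s hs z hz y hy h

theorem borsukUlam_coord (n : ℕ) (g : (Fin (n+1) → ℝ) → (Fin n → ℝ))
    (hg : ContinuousOn g {0}ᶜ) (hodd : ∀ x, g (-x) = - g x) : ∃ x, x ≠ 0 ∧ g x = 0 := by
  by_contra! hcon
  set Kc : Set (Fin (n+1) → ℝ) := {x | ∑ i, |x i| = 1} with hKc
  have hK0 : ∀ x ∈ Kc, x ≠ 0 := by
    rintro x hx rfl
    simp [hKc] at hx
  have hKcomp : IsCompact Kc := by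
    apply Metric.isCompact_of_isClosed_isBounded
    · exact isClosed_eq (by fun_prop) continuous_const
    · refine (Metric.isBounded_closedBall (x := 0) (r := 1)).subset ?_
      intro x hx
      rw [mem_closedBall_zero_iff, pi_norm_le_iff_of_nonneg (by norm_num)]
      intro i
      have hx' : ∑ i, |x i| = 1 := hx
      rw [← hx', Real.norm_eq_abs]
      exact Finset.single_le_sum (f := fun i => |x i|) (fun _ _ => abs_nonneg _) (Finset.mem_univ i)
  have hgK : ContinuousOn g Kc := hg.mono (fun x hx => hK0 x hx)
  have hne : Kc.Nonempty := by
    refine ⟨ebas n 0, ?_⟩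
    have := Oset_abs (n := n) (ε := fun _ => 1) (fun _ => Or.inl rfl)
      (ebas_mem (fun _ => Or.inl rfl) (i := 0) (by omega))
    show ∑ i, |ebas n 0 i| = 1
    simpa using this
  obtain ⟨x0, hx0, hmin⟩ := hKcomp.exists_isMinOn hne hgK.norm
  set μ := ‖g x0‖ with hμ
  have hμ0 : 0 < μ := norm_pos_iff.2 (hcon x0 (hK0 x0 hx0))
  have hμle : ∀ x ∈ Kc, μ ≤ ‖g x‖ := fun x hx => hmin hx
  have huc := hKcomp.uniformContinuousOn_of_continuous hgK
  rw [Metric.uniformContinuousOn_iff] at huc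
  obtain ⟨δ, hδ, huc⟩ := huc μ hμ0
  -- labels
  have hex : ∀ x ∈ Kc, ∃ i : Fin n, μ ≤ |g x i| := by
    intro x hx
    by_contra! h
    have : ‖g x‖ < μ := by
      rw [pi_norm_lt_iff hμ0]; exact h
    linarith [hμle x hx]
  classical
  let idx : (Fin n → ℝ) → ℕ := fun y => sInf {i : ℕ | ∃ h : i < n, μ ≤ |y ⟨i, h⟩|}
  have hidx : ∀ x ∈ Kc, ∃ h : idx (g x) < n, μ ≤ |g x ⟨idx (g x), h⟩| := by
    intro x hx
    obtain ⟨i, hi⟩ := hex x hx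
    exact Nat.sInf_mem (s := {i : ℕ | ∃ h : i < n, μ ≤ |g x ⟨i, h⟩|}) ⟨i, i.2, hi⟩
  let pos : (Fin n → ℝ) → ℕ → Prop := fun y i => ∃ h : i < n, 0 < y ⟨i, h⟩
  let lab : (Fin (n+1) → ℝ) → ℤ := fun x =>
    if pos (g x) (idx (g x)) then (idx (g x) : ℤ) + 1 else -((idx (g x) : ℤ) + 1)
  have hidxneg : ∀ x, idx (g (-x)) = idx (g x) := by
    intro x; simp only [idx, hodd]; simp
  have l1 : ∀ x ∈ Kc, lab x ≠ 0 ∧ |lab x| ≤ n := by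
    intro x hx
    obtain ⟨h, _⟩ := hidx x hx
    simp only [lab]
    split_ifs
    · exact ⟨by omega, by rw [abs_le]; omega⟩
    · exact ⟨by omega, by rw [abs_le]; omega⟩
  have l3 : ∀ x ∈ Kc, lab (-x) = - lab x := by
    intro x hx
    obtain ⟨h, hm⟩ := hidx x hx
    have e1 : lab (-x) = if pos (-(g x)) (idx (g x)) then (idx (g x) : ℤ) + 1
        else -((idx (g x) : ℤ) + 1) := by
      simp only [lab, hidxneg]; rw [hodd]
    rw [e1]
    simp only [lab]
    by_cases hp : 0 < g x ⟨idx (g x), h⟩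
    · rw [if_neg, if_pos ⟨h, hp⟩]
      rintro ⟨_, h'⟩
      simp at h'; linarith
    · rw [if_pos, if_neg, neg_neg]
      · rintro ⟨_, h'⟩; exact hp h'
      · refine ⟨h, ?_⟩
        have : g x ⟨idx (g x), h⟩ ≠ 0 := by
          intro h0; rw [h0, abs_zero] at hm; linarith
        simp only [Pi.neg_apply]
        rcases lt_trichotomy (g x ⟨idx (g x), h⟩) 0 with q | q | q
        · linarith
        · exact absurd q this
        · exact absurd q hp
  have l2 : ∀ x ∈ Kc, ∀ y ∈ Kc, dist x y < δ → lab x ≠ - lab y := by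
    intro x hx y hy hxy heq
    obtain ⟨h, hm⟩ := hidx x hx
    obtain ⟨h', hm'⟩ := hidx y hy
    have hd := huc x hx y hy hxy
    rw [dist_pi_lt_iff hμ0] at hd
    simp only [lab] at heq
    have hi : idx (g x) = idx (g y) := by split_ifs at heq <;> omega
    have hd := hd ⟨idx (g x), h⟩
    have e : (⟨idx (g y), h'⟩ : Fin n) = ⟨idx (g x), h⟩ := Fin.ext hi.symm
    rw [e] at hm'
    rw [Real.dist_eq, abs_lt] at hd
    by_cases hp : 0 < g x ⟨idx (g x), h⟩ <;> by_cases hq : 0 < g y ⟨idx (g x), h⟩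
    · rw [if_pos ⟨h, hp⟩, if_pos ⟨h', by rw [e]; exact hq⟩] at heq; omega
    · rw [abs_of_pos hp] at hm
      rw [abs_of_nonpos (not_lt.1 hq)] at hm'
      linarith
    · rw [abs_of_pos hq] at hm'
      rw [abs_of_nonpos (not_lt.1 hp)] at hm
      linarith
    · rw [if_neg (by rintro ⟨_, q⟩; exact hp q), if_neg (by rintro ⟨_, q⟩; rw [e] at q; exact hq q)]
        at heq
      omega
  -- choose m
  have hc0 : (0:ℝ) ≤ 1 - ((n:ℝ)+1)⁻¹ := by
    rw [sub_nonneg]; exact inv_le_one_of_one_le₀ (by linarith [Nat.cast_nonneg (α := ℝ) n])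
  have hc1 : 1 - ((n:ℝ)+1)⁻¹ < 1 := by
    have : (0:ℝ) < ((n:ℝ)+1)⁻¹ := by positivity
    linarith
  obtain ⟨m, hm⟩ := exists_pow_lt_of_lt_one (show 0 < δ/2 by positivity) hc1
  let cc : ℕ → Ch (Fin (n+1) → ℝ) := fun k => (S bary (k+1))^[m] (cch (ebas n) k)
  have hFconv : ∀ K ∈ Ofam n, Convex ℝ K := by
    rintro K ⟨ε, _, rfl⟩; exact Oset_convex n ε
  have hcc : ∀ k ≤ n, cc k ∈ supp (Gd (Ofam n) (k+1) ((1 - ((n:ℝ)+1)⁻¹)^m * 2)) := fun k hk =>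
    S_iter (Ofam n) hFconv n (k+1) (by omega) m 2 (by norm_num) _ (cch_supp n k hk)
  have hOK : ∀ k s, Gd (Ofam n) k ((1 - ((n:ℝ)+1)⁻¹)^m * 2) s → ∀ x ∈ s, x ∈ Kc := by
    rintro k s ⟨_, ⟨K, ⟨ε, hε, rfl⟩, h⟩, _⟩ x hx
    exact Oset_abs hε (h x hx)
  have hev : ∀ k ≤ n, ev lab n (bd (cc k)) = ev lab n (cc k) + ev lab n (nu (cc k)) := by
    intro k hk
    refine ev_bd lab n _ ?_ ?_ ?_ _ (hcc k hk)
    · intro s hs x hx; exact l1 x (hOK _ s hs x hx)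
    · intro s hs x hx y hy
      refine l2 x (hOK _ s hs x hx) y (hOK _ s hs y hy) ?_
      have := hs.2.2 x hx y hy
      linarith
    · intro s hs x hx; exact l3 x (hOK _ s hs x hx)
  have hone : ∀ k ≤ n, ev lab n (bd (cc k)) = 1 := by
    intro k
    induction k with
    | zero =>
      intro _
      simp only [cc]
      rw [bd_sub, bd_cch_zero]
      have : (S bary 0)^[m] (Finsupp.single 0 1 : Ch (Fin (n+1) → ℝ)) = Finsupp.single 0 1 := by
        simp [S]
      rw [this]
      simp only [ev, Finsupp.linearCombination_single, one_smul, Multiset.map_zero]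
      have : ∀ N, pl N 0 = 1 := by
        intro N; induction N with
        | zero => simp [pl]
        | succ N ih => simp [pl, ih]
      exact this n
    | succ k ih =>
      intro hk
      have : bd (cc (k+1)) = cc k + nu (cc k) := by
        simp only [cc]
        rw [bd_sub, bd_cch_succ, it_add, nu_sub bary bary_neg]
      rw [this, map_add, ← hev k (by omega), ih (by omega)]
  have h0 : ev lab n (cc n) = 0 := by
    have := supp_map (ev lab n) ⊥ (P := fun s => s.card = n+1) (c := cc n) ?_
      (supp_mono (fun t ht => ht.1) (hcc n le_rfl))
    · exact (Submodule.mem_bot _).1 this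
    · intro s hs
      rw [Submodule.mem_bot]
      simp only [ev, Finsupp.linearCombination_single, one_smul]
      exact pl_big n (s.map lab) (by rw [Multiset.card_map, hs]; omega)
  have h0' : ev lab n (nu (cc n)) = 0 := by
    have := supp_map (ev lab n ∘ₗ nu) ⊥ (P := fun s => s.card = n+1) (c := cc n) ?_
      (supp_mono (fun t ht => ht.1) (hcc n le_rfl))
    · exact (Submodule.mem_bot _).1 this
    · intro s hs
      rw [Submodule.mem_bot, LinearMap.comp_apply, nu_single]
      simp only [ev, Finsupp.linearCombination_single, one_smul]
      exact pl_big n _ (by rw [Multiset.card_map, Multiset.card_map, hs]; omega)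
  have := hone n le_rfl
  rw [hev n le_rfl, h0, h0'] at this
  simp at this

theorem borsukUlam {E Y : Type*} [NormedAddCommGroup E] [NormedSpace ℝ E] [FiniteDimensional ℝ E]
    [NormedAddCommGroup Y] [NormedSpace ℝ Y] [FiniteDimensional ℝ Y]
    (hd : Module.finrank ℝ Y < Module.finrank ℝ E) (g : E → Y)
    (hg : ContinuousOn g {0}ᶜ) (hodd : ∀ x, g (-x) = - g x) : ∃ x, x ≠ 0 ∧ g x = 0 := by
  set n := Module.finrank ℝ Y with hn
  obtain ⟨i, hi⟩ : ∃ i : (Fin (n+1) → ℝ) →ₗ[ℝ] E, Function.Injective i := by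
    let bE := Module.finBasis ℝ E
    have hli : LinearIndependent ℝ (bE ∘ Fin.castLE (show n + 1 ≤ Module.finrank ℝ E by omega)) :=
      bE.linearIndependent.comp _ (Fin.castLE_injective _)
    refine ⟨Fintype.linearCombination ℝ (bE ∘ Fin.castLE (show n + 1 ≤ Module.finrank ℝ E by omega)), ?_⟩
    exact hli.fintypeLinearCombination_injective
  let b := Module.finBasis ℝ Y
  let φ : Y ≃L[ℝ] (Fin n → ℝ) := b.equivFun.toContinuousLinearEquiv
  obtain ⟨x, hx, h⟩ := borsukUlam_coord n (fun x => φ (g (i x))) (by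
    refine φ.continuous.comp_continuousOn (hg.comp (i.continuous_of_finiteDimensional.continuousOn) ?_)
    intro x hx h
    exact hx (hi (by simpa using h))) (by intro x; simp [hodd])
  refine ⟨i x, fun h => hx (hi (by simpa using h)), ?_⟩
  simpa using h

end BU

namespace BU

theorem minimax {V : Type*} [NormedAddCommGroup V] [InnerProductSpace ℝ V] [FiniteDimensional ℝ V]
    (Φ : V → ℝ) (Φ' : V → (V →L[ℝ] ℝ)) (hΦ : ∀ x, HasFDerivAt Φ (Φ' x) x) (hΦ' : Continuous Φ')
    (heven : ∀ x, Φ (-x) = Φ x) (E W : Submodule ℝ V)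
    (hdim : Module.finrank ℝ V < Module.finrank ℝ E + Module.finrank ℝ W)
    (ρ α β : ℝ) (hρ : 0 < ρ) (hα : 0 < α) (hαβ : α ≤ β)
    (hbdd : Bornology.IsBounded {x | α / 2 ≤ Φ x})
    (hE : ∀ x ∈ E, ‖x‖ = ρ → α ≤ Φ x) (hW : ∀ x ∈ W, Φ x ≤ β) :
    ∃ u, Φ' u = 0 ∧ α / 2 ≤ Φ u ∧ Φ u ≤ β + 1 := by
  by_contra! hcon
  have hΦc : Continuous Φ := continuous_iff_continuousAt.2 fun x => (hΦ x).continuousAt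
  set G : V → V := fun x => (InnerProductSpace.toDual ℝ V).symm (Φ' x) with hG
  have hGc : Continuous G := (InnerProductSpace.toDual ℝ V).symm.continuous.comp hΦ'
  have hGi : ∀ x v, Φ' x v = inner ℝ (G x) v := by
    intro x v; simp [hG]
  have hΦodd : ∀ x, Φ' (-x) = - Φ' x := by
    intro x
    have h1 : HasFDerivAt (fun y => Φ (-y)) (-(Φ' (-x))) x := by
      have := (hΦ (-x)).comp x (hasFDerivAt_id x).neg
      have e : Φ' (-x) ∘SL (-ContinuousLinearMap.id ℝ V) = -(Φ' (-x)) := by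
        ext v; simp
      rw [e] at this
      exact this
    have h2 : HasFDerivAt (fun y => Φ (-y)) (Φ' x) x := by
      simpa only [heven] using hΦ x
    have := h1.unique h2
    rw [← this, neg_neg]
  have hGodd : ∀ x, G (-x) = - G x := by
    intro x; simp [hG, hΦodd]
  have hKb : IsCompact {x | α / 2 ≤ Φ x} :=
    Metric.isCompact_of_isClosed_isBounded (isClosed_le continuous_const hΦc) hbdd
  -- lower bound on gradient
  obtain ⟨δ, hδ, hδG⟩ : ∃ δ > 0, ∀ u, α / 2 ≤ Φ u → Φ u ≤ β + 1 → δ ≤ ‖G u‖ := by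
    have hB : IsCompact ({x | α / 2 ≤ Φ x} ∩ {x | Φ x ≤ β + 1}) :=
      hKb.inter_right (isClosed_le hΦc continuous_const)
    rcases ({x | α / 2 ≤ Φ x} ∩ {x | Φ x ≤ β + 1}).eq_empty_or_nonempty with h | h
    · refine ⟨1, one_pos, fun u h1 h2 => ?_⟩
      have : u ∈ ({x | α / 2 ≤ Φ x} ∩ {x | Φ x ≤ β + 1}) := ⟨h1, h2⟩
      rw [h] at this; exact this.elim
    · obtain ⟨u0, hu0, hmin⟩ := hB.exists_isMinOn h hGc.norm.continuousOn
      refine ⟨‖G u0‖, ?_, fun u h1 h2 => hmin ⟨h1, h2⟩⟩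
      rw [gt_iff_lt, norm_pos_iff]
      intro h0
      have : Φ' u0 = 0 := by
        ext v; rw [hGi, h0]; simp
      exact absurd hu0.2 (not_le.2 (hcon u0 this hu0.1))
  obtain ⟨R, hR⟩ := hbdd.subset_closedBall (0:V)
  obtain ⟨L, hL⟩ := (isCompact_closedBall (0:V) R).exists_bound_of_continuousOn hGc.continuousOn
  have huc := (isCompact_closedBall (0:V) (R+1)).uniformContinuousOn_of_continuous hGc.continuousOn
  rw [Metric.uniformContinuousOn_iff] at huc
  obtain ⟨η, hη, huc⟩ := huc (δ/2) (by positivity)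
  set L' := max L 0 + 1 with hL'
  have hL'0 : 0 < L' := by have := le_max_right L 0; linarith
  have hLL' : L < L' := by have := le_max_left L 0; linarith
  obtain ⟨s, hs0, hs1, hs2, hs3⟩ : ∃ s > 0, s * L' ≤ 1 ∧ s * L' < η ∧ s * δ^2 ≤ 8 := by
    have t1 : Tendsto (fun s : ℝ => s * L') (𝓝[>] 0) (𝓝 0) := by
      have : Tendsto (fun s : ℝ => s * L') (𝓝 0) (𝓝 (0 * L')) := (continuous_id.mul continuous_const).tendsto 0
      rw [zero_mul] at this; exact this.mono_left nhdsWithin_le_nhds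
    have t2 : Tendsto (fun s : ℝ => s * δ^2) (𝓝[>] 0) (𝓝 0) := by
      have : Tendsto (fun s : ℝ => s * δ^2) (𝓝 0) (𝓝 (0 * δ^2)) := (continuous_id.mul continuous_const).tendsto 0
      rw [zero_mul] at this; exact this.mono_left nhdsWithin_le_nhds
    obtain ⟨s, h1, h2, h3, h4⟩ := ((t1.eventually_le_const (show (0:ℝ) < 1 by norm_num)).and
      ((t1.eventually_lt_const hη).and ((t2.eventually_le_const (show (0:ℝ) < 8 by norm_num)).and
        self_mem_nhdsWithin))).exists
    exact ⟨s, h4, h1, h2, h3⟩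
  have hstep : ∀ u, α / 2 ≤ Φ u →
      Φ u + s * (‖G u‖^2 - δ/2 * ‖G u‖) ≤ Φ (u + s • G u) := by
    intro u hu
    have huR : u ∈ Metric.closedBall (0:V) R := hR hu
    have hgu : ‖G u‖ ≤ L' := (hL u huR).trans hLL'.le
    have hd : ∀ t, HasDerivAt (fun t : ℝ => Φ (u + t • G u)) (inner ℝ (G (u + t • G u)) (G u)) t := by
      intro t
      have h1 : HasDerivAt (fun t : ℝ => u + t • G u) (G u) t := by
        simpa using ((hasDerivAt_id t).smul_const (G u)).const_add u
      have := (hΦ (u + t • G u)).comp_hasDerivAt t h1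
      rw [hGi] at this
      exact this
    obtain ⟨t, ht, hmv⟩ := exists_hasDerivAt_eq_slope (fun t : ℝ => Φ (u + t • G u)) _ hs0
      (fun t _ => (hd t).continuousAt.continuousWithinAt) (fun t _ => hd t)
    simp only [zero_smul, add_zero, sub_zero] at hmv
    rw [eq_div_iff hs0.ne'] at hmv
    have hnt : ‖t • G u‖ ≤ s * L' := by
      rw [norm_smul, Real.norm_of_nonneg ht.1.le]
      exact mul_le_mul ht.2.le hgu (norm_nonneg _) hs0.le
    have hclose : ‖G (u + t • G u) - G u‖ ≤ δ/2 := by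
      rw [← dist_eq_norm]
      refine (huc _ ?_ _ ?_ ?_).le
      · rw [mem_closedBall_zero_iff] at huR ⊢
        linarith [norm_add_le u (t • G u)]
      · rw [mem_closedBall_zero_iff] at huR ⊢; linarith
      · rw [dist_eq_norm, add_sub_cancel_left]; linarith
    have h2 : ‖G u‖^2 - δ/2 * ‖G u‖ ≤ inner ℝ (G (u + t • G u)) (G u) := by
      have e : inner ℝ (G (u + t • G u)) (G u) = ‖G u‖^2 + inner ℝ (G (u + t • G u) - G u) (G u) := by
        rw [inner_sub_left, real_inner_self_eq_norm_sq]; ring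
      have h3 := abs_real_inner_le_norm (G (u + t • G u) - G u) (G u)
      have h4 := mul_le_mul_of_nonneg_right hclose (norm_nonneg (G u))
      rw [e]
      linarith [(abs_le.1 h3).1]
    have := mul_le_mul_of_nonneg_left h2 hs0.le
    linarith
  set c := s * (δ^2 / 2) with hc
  have hc0 : 0 < c := by positivity
  set T : V → V := fun u => u + s • G u with hT
  have hTc : Continuous T := by fun_prop
  have hTodd : ∀ x, T (-x) = - T x := by
    intro x; simp only [hT, hGodd, smul_neg, neg_add]
  have hup : ∀ u, α / 2 ≤ Φ u → min (Φ u + c) (β + 1/2) ≤ Φ (T u) := by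
    intro u hu
    have h1 := hstep u hu
    by_cases h2 : Φ u ≤ β + 1
    · refine (min_le_left _ _).trans (le_trans ?_ h1)
      have h3 := hδG u hu h2
      have : δ^2/2 ≤ ‖G u‖^2 - δ/2 * ‖G u‖ := by nlinarith
      have := mul_le_mul_of_nonneg_left this hs0.le
      linarith
    · refine (min_le_right _ _).trans (le_trans ?_ h1)
      have : -(δ^2/16) ≤ ‖G u‖^2 - δ/2 * ‖G u‖ := by nlinarith [sq_nonneg (‖G u‖ - δ/4)]
      have := mul_le_mul_of_nonneg_left this hs0.le
      linarith
  have hit : ∀ k : ℕ, ∀ u, α ≤ Φ u → min (α + k * c) (β + 1/2) ≤ Φ (T^[k] u) := by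
    intro k u hu
    induction k with
    | zero => simp [hu]
    | succ k ih =>
      rw [Function.iterate_succ_apply']
      have hk : (0:ℝ) ≤ k * c := by positivity
      have : α / 2 ≤ Φ (T^[k] u) := by
        refine le_trans ?_ ih
        rw [le_min_iff]; constructor <;> linarith
      refine le_trans ?_ (hup _ this)
      rw [le_min_iff]
      refine ⟨?_, min_le_right _ _⟩
      push_cast
      rcases min_cases (α + k * c) (β + 1/2) with ⟨h, _⟩ | ⟨h, _⟩
      · rw [h] at ih
        exact (min_le_left _ _).trans (by linarith)
      · rw [h] at ih
        exact (min_le_right _ _).trans (by linarith)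
  obtain ⟨k, hk⟩ := exists_nat_gt ((β + 1/2 - α) / c)
  rw [div_lt_iff₀ hc0] at hk
  have hTk : ∀ k : ℕ, ∀ x, T^[k] (-x) = - T^[k] x := by
    intro k x
    induction k with
    | zero => simp
    | succ k ih => rw [Function.iterate_succ_apply', ih, hTodd, Function.iterate_succ_apply']
  have hTkc : Continuous (T^[k]) := hTc.iterate k
  obtain ⟨x, hx0, hx⟩ := borsukUlam (E := E) (Y := Wᗮ) (by
    have := Submodule.finrank_add_finrank_orthogonal W
    omega) (fun x => Wᗮ.orthogonalProjection (T^[k] ((ρ / ‖x‖) • (x:V)))) (by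
    refine (Wᗮ.orthogonalProjection.continuous.comp hTkc).comp_continuousOn ?_
    refine ContinuousOn.smul ?_ continuous_subtype_val.continuousOn
    refine continuousOn_const.div continuous_norm.continuousOn ?_
    intro x hx; simpa using hx) (by
    intro x
    simp only [norm_neg, Submodule.coe_neg, smul_neg, hTk, map_neg])
  have hmem : T^[k] ((ρ / ‖x‖) • (x:V)) ∈ W := by
    rw [Submodule.orthogonalProjection_eq_zero_iff, Submodule.orthogonal_orthogonal] at hx
    exact hx
  have hxn : 0 < ‖x‖ := norm_pos_iff.2 hx0
  have h1 := hE ((ρ / ‖x‖) • (x:V)) (E.smul_mem _ x.2) (by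
    rw [norm_smul, Real.norm_of_nonneg (by positivity), Submodule.coe_norm, div_mul_cancel₀]
    exact hxn.ne')
  have h2 := hit k _ h1
  have h3 := hW _ hmem
  rw [min_eq_right (by linarith)] at h2
  linarith
end BU

namespace BU

lemma hasDerivAt_F {f : ℝ → ℝ} (hc : Continuous f) (t : ℝ) : HasDerivAt (primF f) (f t) t :=
  (hc.integral_hasStrictDerivAt 0 t).hasDerivAt

lemma cont_F {f : ℝ → ℝ} (hc : Continuous f) : Continuous (primF f) :=
  continuous_iff_continuousAt.2 fun t => (hasDerivAt_F hc t).continuousAt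

lemma F_zero (f : ℝ → ℝ) : primF f 0 = 0 := by simp [primF]

lemma F_even {f : ℝ → ℝ} (hodd : ∀ t : ℝ, f (-t) = -f t) (t : ℝ) : primF f (-t) = primF f t := by
  unfold primF
  have h := intervalIntegral.integral_comp_neg (a := 0) (b := t) (f := f)
  simp only [hodd, neg_zero, intervalIntegral.integral_neg] at h
  rw [intervalIntegral.integral_symm, ← h, neg_neg]

lemma F_nonneg {f : ℝ → ℝ} (hf : HypH f) (t : ℝ) : 0 ≤ primF f t := by
  by_cases h : t = 0
  · rw [h, F_zero]
  · linarith [(hf.2.2.2.1 t h).1]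

lemma F_le {f : ℝ → ℝ} (hf : HypH f) (t : ℝ) : 2 * primF f t ≤ f t * t := by
  by_cases h : t = 0
  · rw [h, F_zero]; simp
  · exact (hf.2.2.2.1 t h).2

lemma growth {f : ℝ → ℝ} (hf : HypH f) {a : ℝ} (ha : 0 < a) :
    ∃ C : ℝ, 0 ≤ C ∧ ∀ t, |f t| ≤ C * exp (a * t^2) := by
  have hc : Continuous f := hf.1
  have ht := hf.2.2.2.2.2 a ha
  have h1 := ht.eventually_le_const (show (0:ℝ) < 1 by norm_num)
  rw [Filter.Eventually, Filter.mem_cocompact] at h1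
  obtain ⟨K, hK, hKs⟩ := h1
  obtain ⟨C, hC⟩ := hK.exists_bound_of_continuousOn
    (f := fun t => |f t| * exp (-a * t ^ 2)) (by fun_prop)
  refine ⟨max C 1, by positivity, fun t => ?_⟩
  have : |f t| * exp (-a * t^2) ≤ max C 1 := by
    by_cases h : t ∈ K
    · exact (le_abs_self _).trans ((hC t h).trans (le_max_left _ _))
    · exact le_trans (hKs h) (le_max_right _ _)
  have e : exp (-a * t^2) * exp (a * t^2) = 1 := by rw [← exp_add]; simp
  calc |f t| = |f t| * exp (-a * t^2) * exp (a * t^2) := by rw [mul_assoc, e, mul_one]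
    _ ≤ _ := mul_le_mul_of_nonneg_right this (exp_pos _).le

lemma AR_large {f : ℝ → ℝ} (hf : HypH f) :
    ∃ T : ℝ, 0 < T ∧ ∀ t, T ≤ |t| → 0 < primF f t ∧ 4 * primF f t ≤ f t * t := by
  obtain ⟨t0, ht0, M, hM, h⟩ := hf.2.2.1
  refine ⟨max t0 (4 * M), by positivity, fun t ht => ?_⟩
  obtain ⟨h1, h2⟩ := h t ((le_max_left _ _).trans ht)
  have h3 : 4 * M ≤ |t| := (le_max_right _ _).trans ht
  have h4 := F_le hf t
  refine ⟨h1, ?_⟩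
  have h5 : f t * t = |f t| * |t| := by
    rw [← abs_mul, abs_of_nonneg (by linarith)]
  rw [h5]
  nlinarith [abs_nonneg (f t)]

lemma AR {f : ℝ → ℝ} (hf : HypH f) : ∃ B : ℝ, 0 ≤ B ∧ ∀ t, 4 * primF f t ≤ f t * t + B := by
  obtain ⟨T, hT, h⟩ := AR_large hf
  obtain ⟨C, hC⟩ := (isCompact_Icc (a := -T) (b := T)).exists_bound_of_continuousOn
    (f := fun t => 4 * primF f t) (by have := cont_F hf.1; fun_prop)
  refine ⟨max C 0, by positivity, fun t => ?_⟩
  have h0 := F_le hf t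
  have h1 := F_nonneg hf t
  by_cases ht : T ≤ |t|
  · have := (h t ht).2
    linarith [le_max_right C 0]
  · have := hC t (by rw [mem_Icc, ← abs_le]; linarith)
    have := (le_abs_self _).trans this
    linarith [le_max_left C 0]

lemma superquad {f : ℝ → ℝ} (hf : HypH f) (hodd : ∀ t : ℝ, f (-t) = -f t) (A : ℝ) :
    ∃ B : ℝ, ∀ t, A * t^2 - B ≤ primF f t := by
  obtain ⟨T, hT, h⟩ := AR_large hf
  set c := primF f T / T^4 with hc
  have hc0 : 0 < c := div_pos (h T (le_abs_self _)).1 (by positivity)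
  have hmono : MonotoneOn (fun t => primF f t / t^4) (Ici T) := by
    have hd : ∀ t, T ≤ t → HasDerivAt (fun t => primF f t / t^4)
        ((f t * t^4 - primF f t * (4 * t^3)) / (t^4)^2) t := by
      intro t ht
      have := (hasDerivAt_F hf.1 t).div (hasDerivAt_pow 4 t) (by have : 0 < t := by linarith
                                                                 positivity)
      norm_num at this
      exact this
    refine monotoneOn_of_deriv_nonneg (convex_Ici T) (fun t ht => (hd t ht).continuousAt.continuousWithinAt)
      (fun t ht => (hd t (interior_subset ht)).differentiableAt.differentiableWithinAt) ?_
    intro t ht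
    have ht' : T ≤ t := interior_subset ht
    rw [(hd t ht').deriv]
    have h1 := (h t (ht'.trans (le_abs_self t))).2
    have ht0 : 0 < t := by linarith
    apply div_nonneg _ (by positivity)
    have : f t * t ^ 4 - primF f t * (4 * t ^ 3) = t^3 * (f t * t - 4 * primF f t) := by ring
    rw [this]
    exact mul_nonneg (by positivity) (by linarith)
  have hpos : ∀ t, T ≤ t → c * t^4 ≤ primF f t := by
    intro t ht
    have h1 := hmono (self_mem_Ici (a := T)) (mem_Ici.2 ht) ht
    have ht0 : 0 < t := by linarith
    rw [← le_div_iff₀ (by positivity)]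
    exact h1
  have hall : ∀ t, T ≤ |t| → c * t^4 ≤ primF f t := by
    intro t ht
    rcases abs_cases t with ⟨e, _⟩ | ⟨e, _⟩
    · exact hpos t (e ▸ ht)
    · have := hpos (-t) (e ▸ ht)
      rw [F_even hodd] at this
      linarith [show (-t)^4 = t^4 by ring]
  refine ⟨A^2/(4*c) + |A| * T^2, fun t => ?_⟩
  have hb1 : 0 ≤ A^2/(4*c) := by positivity
  have hb2 : 0 ≤ |A| * T^2 := by positivity
  by_cases ht : T ≤ |t|
  · have h1 := hall t ht
    have : A * t^2 ≤ c * t^4 + A^2/(4*c) := by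
      have e : c * t^4 + A^2/(4*c) - A * t^2 = (2*c*t^2 - A)^2 / (4*c) := by field_simp; ring
      have : 0 ≤ (2*c*t^2 - A)^2 / (4*c) := by positivity
      linarith
    linarith
  · have h1 := F_nonneg hf t
    have h2 : t^2 ≤ T^2 := sq_le_sq.2 (by rw [abs_of_pos hT]; linarith)
    have h3 : A * t^2 ≤ |A| * T^2 := by
      have := le_abs_self A
      nlinarith [abs_nonneg A, sq_nonneg t]
    linarith
end BU

namespace BU

abbrev nuI : Measure ℝ := volume.restrict (Ioo (0:ℝ) 1)

def Dk (u : ℝ → ℝ) : ℝ × ℝ → ℝ := fun p => (u p.1 - u p.2) / |p.1 - p.2|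

lemma Dk_sq (u : ℝ → ℝ) (p : ℝ × ℝ) : (Dk u p)^2 = gagKer u p := by
  simp [Dk, gagKer, div_pow]

lemma Dk_mul (u v : ℝ → ℝ) (p : ℝ × ℝ) : Dk u p * Dk v p = innerKer u v p := by
  simp only [Dk, innerKer]; rw [div_mul_div_comm, sq]

lemma Dk_meas {u : ℝ → ℝ} (hu : Measurable u) : Measurable (Dk u) := by
  unfold Dk; fun_prop

lemma memX_iff (u : ℝ → ℝ) : memX u ↔ Measurable u ∧ MemLp u 2 volume ∧ MemLp (Dk u) 2 volume ∧
    ∀ᵐ x : ℝ, x ∉ Ioo (0 : ℝ) 1 → u x = 0 := by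
  unfold memX memH
  constructor
  · rintro ⟨⟨h1, h2, h3⟩, h4⟩
    refine ⟨h1, (memLp_two_iff_integrable_sq h1.aestronglyMeasurable).2 h2,
      (memLp_two_iff_integrable_sq (Dk_meas h1).aestronglyMeasurable).2 ?_, h4⟩
    simpa only [Dk_sq] using h3
  · rintro ⟨h1, h2, h3, h4⟩
    refine ⟨⟨h1, (memLp_two_iff_integrable_sq h1.aestronglyMeasurable).1 h2, ?_⟩, h4⟩
    have := (memLp_two_iff_integrable_sq (Dk_meas h1).aestronglyMeasurable).1 h3
    simpa only [Dk_sq] using this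

lemma Dk_add (u v : ℝ → ℝ) : Dk (u + v) = Dk u + Dk v := by
  ext p; simp [Dk]; ring

lemma Dk_smul (c : ℝ) (u : ℝ → ℝ) : Dk (c • u) = c • Dk u := by
  ext p; simp [Dk]; ring

def XS : Submodule ℝ (ℝ → ℝ) where
  carrier := {u | memX u}
  add_mem' := by
    intro u v hu hv
    rw [mem_setOf_eq, memX_iff] at *
    refine ⟨hu.1.add hv.1, hu.2.1.add hv.2.1, ?_, ?_⟩
    · rw [Dk_add]; exact hu.2.2.1.add hv.2.2.1
    · filter_upwards [hu.2.2.2, hv.2.2.2] with x h1 h2 hx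
      simp [h1 hx, h2 hx]
  zero_mem' := by
    rw [mem_setOf_eq, memX_iff]
    refine ⟨measurable_zero, MemLp.zero, ?_, by simp⟩
    have : Dk 0 = 0 := by ext p; simp [Dk]
    rw [this]; exact MemLp.zero
  smul_mem' := by
    intro c u hu
    rw [mem_setOf_eq, memX_iff] at *
    refine ⟨hu.1.const_smul c, hu.2.1.const_smul c, ?_, ?_⟩
    · rw [Dk_smul]; exact hu.2.2.1.const_smul c
    · filter_upwards [hu.2.2.2] with x h1 hx
      simp [h1 hx]

lemma _root_.memX.add {u v : ℝ → ℝ} (hu : memX u) (hv : memX v) : memX (u + v) := XS.add_mem hu hv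
lemma _root_.memX.sub {u v : ℝ → ℝ} (hu : memX u) (hv : memX v) : memX (u - v) := XS.sub_mem hu hv
lemma _root_.memX.smul {u : ℝ → ℝ} (c : ℝ) (hu : memX u) : memX (c • u) := XS.smul_mem c hu
lemma _root_.memX.meas {u : ℝ → ℝ} (hu : memX u) : Measurable u := hu.1.1
lemma _root_.memX.memLp {u : ℝ → ℝ} (hu : memX u) : MemLp u 2 volume := ((memX_iff u).1 hu).2.1
lemma _root_.memX.memI {u : ℝ → ℝ} (hu : memX u) : MemLp u 2 nuI := hu.memLp.restrict _
lemma _root_.memX.memD {u : ℝ → ℝ} (hu : memX u) : MemLp (Dk u) 2 volume := ((memX_iff u).1 hu).2.2.1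
lemma _root_.memX.intI {u : ℝ → ℝ} (hu : memX u) : Integrable u nuI := hu.memI.integrable (by norm_num)
lemma _root_.memX.intsq {u : ℝ → ℝ} (hu : memX u) : Integrable (fun x => u x ^ 2) nuI :=
  hu.memI.integrable_sq

lemma _root_.memX.abs {u : ℝ → ℝ} (hu : memX u) : memX (fun x => |u x|) := by
  have hu' := hu
  rw [memX_iff] at hu ⊢
  refine ⟨hu.1.abs, hu.2.1.abs, ?_, ?_⟩
  · refine hu.2.2.1.mono (Dk_meas hu.1.abs).aestronglyMeasurable (Eventually.of_forall fun p => ?_)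
    simp only [Dk, norm_div]
    gcongr
    simp only [Real.norm_eq_abs]
    exact abs_abs_sub_abs_le_abs_sub _ _
  · filter_upwards [hu.2.2.2] with x h1 hx
    simp [h1 hx]

abbrev HH := Lp ℝ 2 (volume : Measure (ℝ × ℝ))

def DD : XS →ₗ[ℝ] HH where
  toFun u := (memX.memD u.2).toLp (Dk u)
  map_add' u v := by
    rw [← MemLp.toLp_add]
    exact MemLp.toLp_congr _ _ (by rw [Submodule.coe_add, Dk_add])
  map_smul' c u := by
    rw [RingHom.id_apply, ← MemLp.toLp_const_smul]
    exact MemLp.toLp_congr _ _ (by rw [Submodule.coe_smul, Dk_smul])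

lemma DD_inner (u v : XS) : inner ℝ (DD u) (DD v) = innerX u v := by
  rw [L2.inner_def]
  unfold innerX
  apply integral_congr_ae
  filter_upwards [(memX.memD u.2).coeFn_toLp, (memX.memD v.2).coeFn_toLp] with p h1 h2
  show inner ℝ ((DD u) p) ((DD v) p) = _
  simp only [DD, LinearMap.coe_mk, AddHom.coe_mk]
  rw [h1, h2, ← Dk_mul]
  simp [mul_comm]

lemma innerX_self (u : ℝ → ℝ) : innerX u u = gagSq u := by
  unfold innerX gagSq
  congr 1; ext p; rw [← Dk_mul, ← Dk_sq, sq]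

lemma DD_norm (u : XS) : ‖DD u‖^2 = gagSq u := by
  rw [← real_inner_self_eq_norm_sq, DD_inner, innerX_self]

lemma gagSq_nonneg (u : ℝ → ℝ) : 0 ≤ gagSq u :=
  integral_nonneg fun p => by rw [← Dk_sq]; positivity

lemma gagSq_smul (c : ℝ) (u : ℝ → ℝ) : gagSq (c • u) = c^2 * gagSq u := by
  unfold gagSq
  rw [← integral_const_mul]
  congr 1; ext p; rw [← Dk_sq, ← Dk_sq, Dk_smul]; simp; ring

lemma innerX_le {u v : ℝ → ℝ} (hu : memX u) (hv : memX v) :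
    |innerX u v| ≤ √(gagSq u) * √(gagSq v) := by
  have := abs_real_inner_le_norm (DD ⟨u, hu⟩) (DD ⟨v, hv⟩)
  rw [DD_inner] at this
  have e : ∀ w : XS, ‖DD w‖ = √(gagSq w) := fun w => by
    rw [← DD_norm, Real.sqrt_sq (norm_nonneg _)]
  rw [e, e] at this
  exact this

/-- Poincare -/
lemma poincare {u : ℝ → ℝ} (hu : memX u) : ∫ x, u x ^ 2 ∂nuI ≤ 4 * gagSq u := by
  have hi : Integrable (gagKer u) := hu.1.2.2
  have h1 : ∫ p in Ioo (0:ℝ) 1 ×ˢ Ioo (1:ℝ) 2, gagKer u p ≤ gagSq u :=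
    setIntegral_le_integral hi (Eventually.of_forall fun p => by
      simp only [Pi.zero_apply]; rw [← Dk_sq]; positivity)
  have hz : ∀ᵐ p : ℝ × ℝ, p.2 ∉ Ioo (0:ℝ) 1 → u p.2 = 0 :=
    Measure.quasiMeasurePreserving_snd.ae hu.2
  have h2 : ∫ p in Ioo (0:ℝ) 1 ×ˢ Ioo (1:ℝ) 2, (u p.1)^2 * (1/4) ≤
      ∫ p in Ioo (0:ℝ) 1 ×ˢ Ioo (1:ℝ) 2, gagKer u p := by
    refine setIntegral_mono_ae_restrict ?_ hi.integrableOn ?_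
    · have : Integrable (fun p : ℝ × ℝ => (u p.1)^2 * (1/4))
          ((volume.restrict (Ioo (0:ℝ) 1)).prod (volume.restrict (Ioo (1:ℝ) 2))) :=
        hu.intsq.mul_prod (integrable_const (1/4))
      rw [Measure.prod_restrict] at this
      exact this
    · filter_upwards [ae_restrict_of_ae hz,
        ae_restrict_mem (measurableSet_Ioo.prod measurableSet_Ioo)] with p hp hm
      obtain ⟨⟨a1, a2⟩, ⟨b1, b2⟩⟩ := hm
      have e : u p.2 = 0 := hp (fun h => by linarith [h.2])
      simp only [gagKer, e, sub_zero]
      rw [div_eq_mul_inv]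
      refine mul_le_mul_of_nonneg_left ?_ (sq_nonneg _)
      rw [one_mul]
      apply inv_anti₀
      · rw [sq_abs]; apply sq_pos_of_neg; linarith
      · rw [sq_abs]; nlinarith
  have h3 : ∫ p in Ioo (0:ℝ) 1 ×ˢ Ioo (1:ℝ) 2, (u p.1)^2 * (1/4) = (∫ x, u x ^ 2 ∂nuI) * (1/4) := by
    rw [Measure.volume_eq_prod, setIntegral_prod_mul (fun x => u x ^2) (fun _ => (1/4:ℝ))]
    simp; left; norm_num
  linarith

lemma cs {g h : ℝ → ℝ} (hg : MemLp g 2 nuI) (hh : MemLp h 2 nuI) :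
    |∫ x, g x * h x ∂nuI| ≤ √(∫ x, g x ^2 ∂nuI) * √(∫ x, h x ^ 2 ∂nuI) := by
  have := abs_real_inner_le_norm (hg.toLp g) (hh.toLp h)
  have key : ∀ (a b : ℝ → ℝ) (ha : MemLp a 2 nuI) (hb : MemLp b 2 nuI),
      inner ℝ (ha.toLp a) (hb.toLp b) = ∫ x, a x * b x ∂nuI := by
    intro a b ha hb
    rw [L2.inner_def]
    apply integral_congr_ae
    filter_upwards [ha.coeFn_toLp, hb.coeFn_toLp] with p h1 h2
    rw [h1, h2]; simp [mul_comm]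
  have kn : ∀ (a : ℝ → ℝ) (ha : MemLp a 2 nuI), ‖ha.toLp a‖ = √(∫ x, a x ^2 ∂nuI) := by
    intro a ha
    rw [← Real.sqrt_sq (norm_nonneg (ha.toLp a)), ← real_inner_self_eq_norm_sq, key]
    simp only [sq]
  rw [key, kn, kn] at this
  exact this

/-- zero seminorm implies zero -/
lemma ae_zero {u : ℝ → ℝ} (hu : memX u) (h : gagSq u = 0) : u =ᵐ[volume] 0 := by
  have h1 := poincare hu
  rw [h, mul_zero] at h1
  have h2 : ∫ x, u x ^ 2 ∂nuI = 0 := le_antisymm h1 (integral_nonneg fun x => sq_nonneg _)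
  rw [integral_eq_zero_iff_of_nonneg (fun x => sq_nonneg _) hu.intsq] at h2
  have h3 := (ae_restrict_iff' measurableSet_Ioo).1 h2
  filter_upwards [h3, hu.2] with x h4 h5
  by_cases hx : x ∈ Ioo (0:ℝ) 1
  · simpa using h4 hx
  · exact h5 hx

lemma gagSq_congr {u v : ℝ → ℝ} (h : u =ᵐ[volume] v) : gagSq u = gagSq v := by
  unfold gagSq
  apply integral_congr_ae
  filter_upwards [Measure.quasiMeasurePreserving_snd.ae h, Measure.quasiMeasurePreserving_fst.ae h]
    with p h1 h2
  simp only [gagKer]; rw [h1, h2]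

end BU

namespace BU

lemma TM_exp {ω : ℝ} (hω0 : 0 < ω) (hTM : TMprop ω) {R : ℝ} (hR : 0 < R) :
    ∃ a > (0:ℝ), ∃ K ≥ (0:ℝ), ∀ u, memX u → gagSq u ≤ R^2 →
      Integrable (fun x => exp (a * u x ^ 2)) nuI ∧ ∫ x, exp (a * u x ^ 2) ∂nuI ≤ K := by
  obtain ⟨K, hK, h⟩ := hTM (π * ω) (by positivity) (by nlinarith [Real.pi_pos, mul_pos Real.pi_pos hω0])
  refine ⟨π * ω / R^2, by positivity, K, hK.le, fun u hu hg => ?_⟩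
  have h1 := h (R⁻¹ • u) (hu.smul _) (by
    unfold gagNorm
    rw [Real.sqrt_le_left zero_le_one, one_pow, gagSq_smul, inv_pow, inv_mul_le_iff₀ (by positivity)]
    linarith)
  have e : ∀ x, π * ω * (R⁻¹ • u) x ^ 2 = π * ω / R^2 * u x ^ 2 := by
    intro x; simp; field_simp
  simp only [e] at h1
  have hm : Measurable (fun x => exp (π * ω / R^2 * u x ^ 2)) := by
    have := hu.meas; fun_prop
  have hi : Integrable (fun x => exp (π * ω / R^2 * u x ^ 2)) nuI := by
    refine ⟨hm.aestronglyMeasurable, ?_⟩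
    rw [hasFiniteIntegral_iff_ofReal (Eventually.of_forall fun x => (exp_pos _).le)]
    exact h1.trans_lt ENNReal.ofReal_lt_top
  refine ⟨hi, ?_⟩
  rw [integral_eq_lintegral_of_nonneg_ae (Eventually.of_forall fun x => (exp_pos _).le)
    hm.aestronglyMeasurable]
  exact ENNReal.toReal_le_of_le_ofReal hK.le h1

lemma f_bound {ω : ℝ} (hω0 : 0 < ω) (hTM : TMprop ω) {f : ℝ → ℝ} (hf : HypH f) {R : ℝ} (hR : 0 < R) :
    ∃ C ≥ (0:ℝ), ∀ u, memX u → gagSq u ≤ R^2 →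
      MemLp (fun x => f (u x)) 2 nuI ∧ ∫ x, f (u x) ^ 2 ∂nuI ≤ C := by
  obtain ⟨a, ha, K, hK, h⟩ := TM_exp hω0 hTM hR
  obtain ⟨C, hC, hg⟩ := growth hf (show 0 < a/2 by positivity)
  refine ⟨C^2 * K, by positivity, fun u hu hgu => ?_⟩
  obtain ⟨hi, hK'⟩ := h u hu hgu
  have hb : ∀ x, f (u x) ^2 ≤ C^2 * exp (a * u x ^ 2) := by
    intro x
    have h1 := hg (u x)
    have h2 : exp (a * u x ^ 2) = exp (a/2 * u x ^ 2)^2 := by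
      rw [← exp_nat_mul]; congr 1; push_cast; ring
    rw [h2, ← mul_pow, ← sq_abs (f (u x))]
    exact pow_le_pow_left₀ (abs_nonneg _) h1 2
  have hm : Measurable (fun x => f (u x)) := hf.1.measurable.comp hu.meas
  have hi2 : Integrable (fun x => f (u x) ^2) nuI := by
    refine (hi.const_mul (C^2)).mono' (hm.pow_const 2).aestronglyMeasurable (Eventually.of_forall fun x => ?_)
    rw [Real.norm_of_nonneg (sq_nonneg _)]
    exact hb x
  refine ⟨(memLp_two_iff_integrable_sq hm.aestronglyMeasurable).2 hi2, ?_⟩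
  calc ∫ x, f (u x) ^ 2 ∂nuI ≤ ∫ x, C^2 * exp (a * u x ^ 2) ∂nuI :=
        integral_mono hi2 (hi.const_mul _) hb
    _ = C^2 * ∫ x, exp (a * u x ^ 2) ∂nuI := integral_const_mul _ _
    _ ≤ C^2 * K := by gcongr

lemma f_mem {ω : ℝ} (hω0 : 0 < ω) (hTM : TMprop ω) {f : ℝ → ℝ} (hf : HypH f) {u : ℝ → ℝ}
    (hu : memX u) : MemLp (fun x => f (u x)) 2 nuI := by
  obtain ⟨C, _, h⟩ := f_bound hω0 hTM hf (R := √(gagSq u) + 1) (by positivity)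
  refine (h u hu ?_).1
  have := Real.sq_sqrt (gagSq_nonneg u)
  nlinarith [Real.sqrt_nonneg (gagSq u)]

lemma f_dom {ω : ℝ} (hω0 : 0 < ω) (hTM : TMprop ω) {f : ℝ → ℝ} (hf : HypH f) {g : ℝ → ℝ}
    (hg : memX g) (r : ℝ) : ∃ h : ℝ → ℝ, MemLp h 2 nuI ∧ ∀ x s, |s| ≤ r * g x → |f s| ≤ h x := by
  obtain ⟨a, ha, K, hK, h⟩ := TM_exp hω0 hTM (R := √(gagSq (r • g)) + 1) (by positivity)
  obtain ⟨C, hC, hgr⟩ := growth hf (show 0 < a/2 by positivity)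
  have hi := (h (r • g) (hg.smul r) (by
    have := Real.sq_sqrt (gagSq_nonneg (r • g))
    nlinarith [Real.sqrt_nonneg (gagSq (r • g))])).1
  refine ⟨fun x => C * exp (a/2 * (r * g x)^2), ?_, ?_⟩
  · have hm : Measurable (fun x => C * exp (a/2 * (r * g x)^2)) := by
      have := hg.meas; fun_prop
    rw [memLp_two_iff_integrable_sq hm.aestronglyMeasurable]
    refine (hi.const_mul (C^2)).congr (Eventually.of_forall fun x => ?_)
    simp only [Pi.smul_apply, smul_eq_mul]
    rw [mul_pow C, ← exp_nat_mul]; congr 2; push_cast; ring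
  · intro x s hs
    refine (hgr s).trans ?_
    have : s^2 ≤ (r * g x)^2 := sq_le_sq.2 (hs.trans (le_abs_self _))
    exact mul_le_mul_of_nonneg_left (exp_le_exp.2 (mul_le_mul_of_nonneg_left this (by positivity))) hC

lemma F_int {ω : ℝ} (hω0 : 0 < ω) (hTM : TMprop ω) {f : ℝ → ℝ} (hf : HypH f) {u : ℝ → ℝ}
    (hu : memX u) : Integrable (fun x => primF f (u x)) nuI := by
  have h1 : Integrable (fun x => f (u x) * u x) nuI := (f_mem hω0 hTM hf hu).integrable_mul hu.memI
  refine h1.mono' ((cont_F hf.1).measurable.comp hu.meas).aestronglyMeasurable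
    (Eventually.of_forall fun x => ?_)
  have := F_nonneg hf (u x)
  rw [Real.norm_of_nonneg this]
  linarith [F_le hf (u x)]

lemma F_int_le {ω : ℝ} (hω0 : 0 < ω) (hTM : TMprop ω) {f : ℝ → ℝ} (hf : HypH f) {u : ℝ → ℝ}
    (hu : memX u) : 2 * ∫ x, primF f (u x) ∂nuI ≤ ∫ x, f (u x) * u x ∂nuI := by
  rw [← integral_const_mul]
  exact integral_mono ((F_int hω0 hTM hf hu).const_mul 2)
    ((f_mem hω0 hTM hf hu).integrable_mul hu.memI) (fun x => F_le hf (u x))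

/-- average functional -/
def av (n k : ℕ) (u : ℝ → ℝ) : ℝ := ∫ x in Ioc ((k:ℝ)/n) (((k:ℝ)+1)/n), u x

lemma nuI_eq : nuI = volume.restrict (Ioc (0:ℝ) 1) := Measure.restrict_congr_set Ioo_ae_eq_Ioc

lemma one_int {u : ℝ → ℝ} (hu : memX u) (a h : ℝ) (hh : 0 < h) :
    ∫ x in Ioc a (a+h), u x ^ 2 ≤ h⁻¹ * (∫ x in Ioc a (a+h), u x)^2
      + h * ∫ p in Ioc a (a+h) ×ˢ Ioc a (a+h), gagKer u p := by
  set I := Ioc a (a+h) with hI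
  set m : Measure ℝ := volume.restrict I with hm
  have hmr : m.real univ = h := by
    simp [hm, hI, Measure.real, hh.le]
  have hfin : IsFiniteMeasure m := by
    constructor; simp [hm, hI]
  have hL : MemLp u 2 m := hu.memLp.restrict _
  have i1 : Integrable u m := hL.integrable (by norm_num)
  have i2 : Integrable (fun x => u x ^ 2) m := hL.integrable_sq
  have hi : Integrable (gagKer u) := hu.1.2.2
  have hprod : m.prod m = (volume : Measure (ℝ × ℝ)).restrict (I ×ˢ I) := by
    rw [Measure.prod_restrict, Measure.volume_eq_prod]
  have j1 : Integrable (fun p : ℝ × ℝ => u p.1 ^ 2) (m.prod m) := i2.comp_fst m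
  have j2 : Integrable (fun p : ℝ × ℝ => u p.2 ^ 2) (m.prod m) := i2.comp_snd m
  have j3 : Integrable (fun p : ℝ × ℝ => u p.1 * u p.2) (m.prod m) := i1.mul_prod i1
  have h1 : ∫ p, (u p.1 - u p.2)^2 ∂(m.prod m) = 2 * h * ∫ x, u x ^ 2 ∂m - 2 * (∫ x, u x ∂m)^2 := by
    have : ∀ p : ℝ × ℝ, (u p.1 - u p.2)^2 = u p.1 ^ 2 + u p.2 ^ 2 - 2 * (u p.1 * u p.2) := by
      intro p; ring
    simp_rw [this]
    rw [integral_sub (by exact j1.add j2) (j3.const_mul 2), integral_add j1 j2, integral_const_mul,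
      integral_prod_mul (μ := m) (ν := m) u u, integral_fun_fst (μ := m) (ν := m) (fun x => u x ^ 2),
      integral_fun_snd (μ := m) (ν := m) (fun x => u x ^ 2), hmr]
    simp; ring
  have h2 : ∫ p, (u p.1 - u p.2)^2 ∂(m.prod m) ≤ ∫ p, h^2 * gagKer u p ∂(m.prod m) := by
    have hgi : Integrable (gagKer u) (m.prod m) := by rw [hprod]; exact hi.integrableOn
    refine integral_mono_ae ?_ (hgi.const_mul _) ?_
    · have : ∀ p : ℝ × ℝ, (u p.1 - u p.2)^2 = u p.1 ^ 2 + u p.2 ^ 2 - 2 * (u p.1 * u p.2) := by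
        intro p; ring
      simp_rw [this]
      exact (j1.add j2).sub (j3.const_mul 2)
    · rw [hprod]
      filter_upwards [ae_restrict_mem (measurableSet_Ioc.prod measurableSet_Ioc)] with p hp
      obtain ⟨⟨a1, a2⟩, ⟨b1, b2⟩⟩ := hp
      by_cases he : p.1 = p.2
      · simp [gagKer, he]
      · have hpos : 0 < |p.1 - p.2|^2 := by
          have : 0 < |p.1 - p.2| := abs_pos.2 (sub_ne_zero.2 he)
          positivity
        have hle : |p.1 - p.2|^2 ≤ h^2 := by
          refine pow_le_pow_left₀ (abs_nonneg _) ?_ 2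
          rw [abs_le]; constructor <;> linarith
        simp only [gagKer]
        rw [← mul_div_assoc, le_div_iff₀ hpos, mul_comm]
        exact mul_le_mul_of_nonneg_right hle (sq_nonneg _)
  rw [h1, integral_const_mul, hprod] at h2
  set A := ∫ x, u x ^ 2 ∂m
  set B := ∫ x, u x ∂m
  set G := ∫ p in I ×ˢ I, gagKer u p
  have hG : 0 ≤ G := integral_nonneg fun p => by rw [← Dk_sq]; positivity
  have : h * A ≤ h * (h⁻¹ * B^2 + h * G) := by
    have e : h * (h⁻¹ * B^2 + h * G) = B^2 + h^2 * G := by field_simp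
    rw [e]; nlinarith [mul_nonneg (sq_nonneg h) hG]
  exact le_of_mul_le_mul_left this hh

lemma averaging {u : ℝ → ℝ} (hu : memX u) (n : ℕ) (hn : 0 < n) :
    ∫ x, u x ^ 2 ∂nuI ≤ n * ∑ k ∈ Finset.range n, (av n k u)^2 + (n:ℝ)⁻¹ * gagSq u := by
  have hn' : (0:ℝ) < n := by exact_mod_cast hn
  have hi : Integrable (gagKer u) := hu.1.2.2
  have hsq : Integrable (fun x => u x ^2) := hu.memLp.integrable_sq
  set a : ℕ → ℝ := fun k => (k:ℝ)/n with ha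
  have ha1 : ∀ k : ℕ, a (k+1) = ((k:ℝ)+1)/n := by intro k; simp [ha]
  have ha2 : ∀ k : ℕ, a (k+1) = a k + (n:ℝ)⁻¹ := by intro k; rw [ha1]; simp only [ha]; field_simp
  have hmono : Monotone a := by
    apply monotone_nat_of_le_succ; intro k; rw [ha2]
    have : 0 < (n:ℝ)⁻¹ := by positivity
    linarith
  have e1 : ∫ x, u x ^ 2 ∂nuI = ∑ k ∈ Finset.range n, ∫ x in Ioc (a k) (a (k+1)), u x ^ 2 := by
    have := intervalIntegral.sum_integral_adjacent_intervals (f := fun x => u x ^ 2) (μ := volume)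
      (a := a) (n := n) (fun k _ => hsq.intervalIntegrable)
    have e0 : a 0 = 0 := by simp [ha]
    have en : a n = 1 := by simp only [ha]; field_simp
    rw [e0, en, intervalIntegral.integral_of_le zero_le_one] at this
    rw [nuI_eq, ← this]
    apply Finset.sum_congr rfl
    intro k _
    rw [intervalIntegral.integral_of_le (hmono (Nat.le_succ k))]
  have e2 : ∑ k ∈ Finset.range n, ∫ p in Ioc (a k) (a (k+1)) ×ˢ Ioc (a k) (a (k+1)), gagKer u p
      ≤ gagSq u := by
    rw [← integral_biUnion_finset]
    · exact setIntegral_le_integral hi (Eventually.of_forall fun p => by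
        simp only [Pi.zero_apply]; rw [← Dk_sq]; positivity)
    · intro k _; exact measurableSet_Ioc.prod measurableSet_Ioc
    · intro i _ j _ hij
      have := hmono.pairwise_disjoint_on_Ioc_succ hij
      exact Set.Disjoint.set_prod_left this _ _
    · intro k _; exact hi.integrableOn
  rw [e1]
  have e3 : ∀ k ∈ Finset.range n, ∫ x in Ioc (a k) (a (k+1)), u x ^ 2 ≤ n * (av n k u)^2
      + (n:ℝ)⁻¹ * ∫ p in Ioc (a k) (a (k+1)) ×ˢ Ioc (a k) (a (k+1)), gagKer u p := by
    intro k _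
    have := one_int hu (a k) (n:ℝ)⁻¹ (by positivity)
    rw [← ha2, inv_inv] at this
    unfold av
    rw [← ha1]; exact this
  refine (Finset.sum_le_sum e3).trans ?_
  rw [Finset.sum_add_distrib, ← Finset.mul_sum, ← Finset.mul_sum]
  gcongr
end BU

namespace BU

lemma lip_memX {ψ : ℝ → ℝ} (hlip : ∀ x y, |ψ x - ψ y| ≤ |x - y|) (hb : ∀ x, |ψ x| ≤ 1)
    (hs : ∀ x, x ∉ Ioo (0:ℝ) 1 → ψ x = 0) : memX ψ := by
  have hc : Continuous ψ := (LipschitzWith.of_dist_le_mul (K := 1) (by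
    intro x y; rw [Real.dist_eq, Real.dist_eq]; simpa using hlip x y)).continuous
  have hm : Measurable ψ := hc.measurable
  have hind : Integrable (indicator (Ioo (0:ℝ) 1) (fun _ => (1:ℝ))) volume := by
    rw [integrable_indicator_iff measurableSet_Ioo]
    exact integrableOn_const (by simp)
  refine ⟨⟨hm, ?_, ?_⟩, Eventually.of_forall hs⟩
  · refine hind.mono' (by fun_prop) (Eventually.of_forall fun x => ?_)
    rw [Real.norm_of_nonneg (sq_nonneg _)]
    by_cases hx : x ∈ Ioo (0:ℝ) 1
    · rw [indicator_of_mem hx]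
      rw [← sq_abs]; nlinarith [hb x, abs_nonneg (ψ x)]
    · rw [indicator_of_notMem hx, hs x hx]; simp
  · have h1 : Integrable (fun p : ℝ × ℝ => indicator (Ioo (0:ℝ) 1) (fun _ => (1:ℝ)) p.1
        * (1 + p.2^2)⁻¹) (volume.prod volume) := hind.mul_prod integrable_inv_one_add_sq
    have hmp := measurePreserving_prod_neg_add (volume : Measure ℝ) (volume : Measure ℝ)
    have h2 := hmp.integrable_comp_of_integrable h1
    have h3 := h2.swap
    have h4 := (h2.add h3).const_mul 8
    rw [← Measure.volume_eq_prod] at h4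
    refine h4.mono' ?_ (Eventually.of_forall fun p => ?_)
    · have : gagKer ψ = fun p => (Dk ψ p)^2 := by ext p; rw [Dk_sq]
      rw [this]; exact ((Dk_meas hm).pow_const 2).aestronglyMeasurable
    · rw [← Dk_sq, Real.norm_of_nonneg (sq_nonneg _), Dk_sq]
      simp only [Function.comp, Pi.add_apply, Prod.swap]
      have e : (-p.2 + p.1)^2 = (-p.1 + p.2)^2 := by ring
      rw [e]
      set q := (1 + (-p.1 + p.2)^2)⁻¹ with hq
      have hq0 : 0 ≤ q := by positivity
      have key : gagKer ψ p ≤ 8 * q := by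
        by_cases he : p.1 = p.2
        · simp only [gagKer, he]; simp; exact hq0
        have hd : 0 < |p.1 - p.2| := abs_pos.2 (sub_ne_zero.2 he)
        have hd2 : 0 < |p.1 - p.2|^2 := by positivity
        have e2 : (-p.1 + p.2)^2 = |p.1 - p.2|^2 := by rw [sq_abs]; ring
        have l1 : (ψ p.1 - ψ p.2)^2 ≤ |p.1 - p.2|^2 := by
          rw [← sq_abs (ψ p.1 - ψ p.2)]; exact pow_le_pow_left₀ (abs_nonneg _) (hlip _ _) 2
        have l2 : (ψ p.1 - ψ p.2)^2 ≤ 4 := by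
          have a1 := abs_le.1 (hb p.1); have a2 := abs_le.1 (hb p.2)
          nlinarith
        simp only [gagKer]
        rw [hq, e2, div_le_iff₀ hd2, mul_assoc, inv_mul_eq_div, mul_div_assoc', le_div_iff₀ (by positivity)]
        nlinarith
      by_cases hx : p.1 ∈ Ioo (0:ℝ) 1
      · rw [indicator_of_mem hx]
        have : 0 ≤ indicator (Ioo (0:ℝ) 1) (fun _ => (1:ℝ)) p.2 * q :=
          mul_nonneg (indicator_nonneg (fun _ _ => zero_le_one) _) hq0
        linarith
      · by_cases hy : p.2 ∈ Ioo (0:ℝ) 1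
        · rw [indicator_of_mem hy]
          have : 0 ≤ indicator (Ioo (0:ℝ) 1) (fun _ => (1:ℝ)) p.1 * q :=
            mul_nonneg (indicator_nonneg (fun _ _ => zero_le_one) _) hq0
          linarith
        · simp [gagKer, hs _ hx, hs _ hy, hx, hy]

def tent (m : ℕ) (i : ℕ) : ℝ → ℝ := fun x => max 0 ((2*m:ℝ)⁻¹ - |x - (2*i+1) * (2*m:ℝ)⁻¹|)

lemma tent_cont (m i : ℕ) : Continuous (tent m i) := by unfold tent; fun_prop

lemma tent_memX {m i : ℕ} (hi : i < m) : memX (tent m i) := by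
  have hm : (0:ℝ) < m := by exact_mod_cast (by omega : 0 < m)
  have hm1 : (1:ℝ) ≤ m := by exact_mod_cast (by omega : 1 ≤ m)
  have hr : (0:ℝ) < (2*m:ℝ)⁻¹ := by positivity
  have hr2 : (2*m:ℝ) * (2*m:ℝ)⁻¹ = 1 := mul_inv_cancel₀ (by positivity)
  have him : (i:ℝ) + 1 ≤ m := by exact_mod_cast hi
  set r := (2*m:ℝ)⁻¹
  apply lip_memX
  · intro x y
    unfold tent
    have := abs_max_sub_max_le_abs (r - |x - (2*i+1) * r|) (r - |y - (2*i+1) * r|) 0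
    rw [max_comm, max_comm 0]
    refine this.trans ?_
    have e : (r - |x - (2*i+1) * r|) - (r - |y - (2*i+1) * r|) = -(|x - (2*i+1) * r| - |y - (2*i+1) * r|) := by ring
    rw [e, abs_neg]
    refine (abs_abs_sub_abs_le_abs_sub _ _).trans ?_
    apply le_of_eq; congr 1; ring
  · intro x
    unfold tent
    rw [abs_of_nonneg (le_max_left _ _)]
    apply max_le zero_le_one
    have := abs_nonneg (x - (2*i+1) * r)
    have : r ≤ 1 := by nlinarith
    linarith
  · intro x hx
    unfold tent
    apply max_eq_left
    have hi0 : (0:ℝ) ≤ i := Nat.cast_nonneg i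
    by_contra! h
    apply hx
    have h2 : |x - (2*i+1) * r| < r := by linarith
    rw [abs_lt] at h2
    constructor <;> nlinarith

lemma tent_eval (m i j : ℕ) (hm : 0 < m) :
    tent m i ((2*j+1) * (2*m:ℝ)⁻¹) = if i = j then (2*m:ℝ)⁻¹ else 0 := by
  have hm : (0:ℝ) < m := by exact_mod_cast hm
  have hr : (0:ℝ) < (2*m:ℝ)⁻¹ := by positivity
  unfold tent
  set r := (2*m:ℝ)⁻¹
  split_ifs with h
  · subst h; simp [hr.le]
  · apply max_eq_left
    have e : (2*j+1) * r - (2*i+1) * r = ((2 * ((j:ℤ) - i) : ℤ):ℝ) * r := by push_cast; ring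
    rw [e, abs_mul, abs_of_pos hr]
    have : (1:ℝ) ≤ |((2 * ((j:ℤ) - i) : ℤ):ℝ)| := by
      rw [← Int.cast_abs]
      have : 1 ≤ |2 * ((j:ℤ) - i)| := Int.one_le_abs (by omega)
      exact_mod_cast this
    nlinarith

lemma tent_indep (m : ℕ) : LinearIndependent ℝ
    (fun i : Fin m => DD ⟨tent m i, tent_memX i.2⟩) := by
  rw [Fintype.linearIndependent_iff]
  intro c hc j
  have hm : 0 < m := by have := j.2; omega
  set w : XS := ∑ i : Fin m, c i • ⟨tent m i, tent_memX i.2⟩ with hw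
  have hD : DD w = 0 := by
    rw [hw, map_sum]; simpa using hc
  have hz : (w : ℝ → ℝ) =ᵐ[volume] 0 := by
    apply ae_zero w.2
    rw [← DD_norm, hD]; simp
  have hwf : (w : ℝ → ℝ) = fun x => ∑ i : Fin m, c i * tent m i x := by
    ext x; rw [hw]; simp
  have hcont : Continuous (w : ℝ → ℝ) := by
    rw [hwf]
    exact continuous_finset_sum _ fun i _ => continuous_const.mul (tent_cont m i)
  have hzz := (hcont.ae_eq_iff_eq (μ := volume) continuous_zero).1 hz
  have := congrFun hzz ((2*j+1) * (2*m:ℝ)⁻¹)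
  rw [hwf] at this
  simp only [tent_eval m _ _ hm, Pi.zero_apply] at this
  have e : ∀ i : Fin m, (if (i:ℕ) = (j:ℕ) then (2*m:ℝ)⁻¹ else 0) = if i = j then (2*m:ℝ)⁻¹ else 0 := by
    intro i; simp [Fin.ext_iff]
  simp only [e] at this
  simp at this
  rcases this with h | h
  · exact h
  · omega
end BU

namespace BU

section
variable {V : Type*} [NormedAddCommGroup V] [InnerProductSpace ℝ V] [FiniteDimensional ℝ V]

def gdom (σ : V →ₗ[ℝ] XS) : ℝ → ℝ :=
  ∑ i, (fun x => |(σ (stdOrthonormalBasis ℝ V i) : ℝ → ℝ) x|)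

lemma gdom_mem (σ : V →ₗ[ℝ] XS) : memX (gdom σ) :=
  XS.sum_mem fun i _ => (memX.abs (σ (stdOrthonormalBasis ℝ V i)).2 : memX _)

def Lt (σ : V →ₗ[ℝ] XS) (t : ℝ) : V →L[ℝ] ℝ :=
  ∑ i, ((σ (stdOrthonormalBasis ℝ V i) : ℝ → ℝ) t) • innerSL ℝ (stdOrthonormalBasis ℝ V i)

lemma Lt_apply (σ : V →ₗ[ℝ] XS) (t : ℝ) (x : V) : Lt σ t x = (σ x : ℝ → ℝ) t := by
  conv_rhs => rw [← (stdOrthonormalBasis ℝ V).sum_repr' x]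
  simp [Lt, map_sum, mul_comm]

lemma Lt_norm (σ : V →ₗ[ℝ] XS) (t : ℝ) : ‖Lt σ t‖ ≤ gdom σ t := by
  unfold Lt gdom
  rw [Finset.sum_apply]
  refine (norm_sum_le _ _).trans (Finset.sum_le_sum fun i _ => ?_)
  rw [norm_smul, innerSL_apply_norm, (stdOrthonormalBasis ℝ V).norm_eq_one, mul_one, Real.norm_eq_abs]

lemma gdom_nonneg (σ : V →ₗ[ℝ] XS) (t : ℝ) : 0 ≤ gdom σ t := (norm_nonneg _).trans (Lt_norm σ t)

lemma Lt_meas (σ : V →ₗ[ℝ] XS) : AEStronglyMeasurable (Lt σ) nuI := by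
  have : Lt σ = fun t => ∑ i, ((σ (stdOrthonormalBasis ℝ V i) : ℝ → ℝ) t) •
    (innerSL ℝ (stdOrthonormalBasis ℝ V i) : V →L[ℝ] ℝ) := rfl
  rw [this]
  refine Finset.aestronglyMeasurable_fun_sum _ fun i _ => ?_
  exact (memX.meas (σ (stdOrthonormalBasis ℝ V i)).2).aestronglyMeasurable.smul_const _

lemma sig_le (σ : V →ₗ[ℝ] XS) (t : ℝ) (x : V) : |(σ x : ℝ → ℝ) t| ≤ ‖x‖ * gdom σ t := by
  rw [← Lt_apply]
  refine ((Lt σ t).le_opNorm x).trans ?_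
  rw [mul_comm]
  exact mul_le_mul_of_nonneg_left (Lt_norm σ t) (norm_nonneg _)

def Phi (f : ℝ → ℝ) (σ : V →ₗ[ℝ] XS) (x : V) : ℝ :=
  ‖x‖^2 / (4 * π) - ∫ t, primF f ((σ x : ℝ → ℝ) t) ∂nuI

def Phi' (f : ℝ → ℝ) (σ : V →ₗ[ℝ] XS) (x : V) : V →L[ℝ] ℝ :=
  (2 * π)⁻¹ • innerSL ℝ x - ∫ t, f ((σ x : ℝ → ℝ) t) • Lt σ t ∂nuI

variable {ω : ℝ} {f : ℝ → ℝ}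

lemma dom_int (hω0 : 0 < ω) (hTM : TMprop ω) (hf : HypH f) (σ : V →ₗ[ℝ] XS) (r : ℝ) :
    ∃ b : ℝ → ℝ, Integrable b nuI ∧ ∀ t, ∀ x : V, ‖x‖ ≤ r → ‖f ((σ x : ℝ → ℝ) t) • Lt σ t‖ ≤ b t := by
  obtain ⟨h, hL, hh⟩ := f_dom hω0 hTM hf (gdom_mem σ) r
  refine ⟨fun t => h t * gdom σ t, hL.integrable_mul (gdom_mem σ).memI, fun t x hx => ?_⟩
  rw [norm_smul]
  have h1 := hh t ((σ x : ℝ → ℝ) t)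
    ((sig_le σ t x).trans (mul_le_mul_of_nonneg_right hx (gdom_nonneg σ t)))
  exact mul_le_mul h1 (Lt_norm σ t) (norm_nonneg _) ((abs_nonneg _).trans h1)

lemma sf_meas (hf : HypH f) (σ : V →ₗ[ℝ] XS) (x : V) :
    AEStronglyMeasurable (fun t => f ((σ x : ℝ → ℝ) t) • Lt σ t) nuI :=
  (hf.1.measurable.comp (memX.meas (σ x).2)).aestronglyMeasurable.smul (Lt_meas σ)

lemma sf_int (hω0 : 0 < ω) (hTM : TMprop ω) (hf : HypH f) (σ : V →ₗ[ℝ] XS) (x : V) :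
    Integrable (fun t => f ((σ x : ℝ → ℝ) t) • Lt σ t) nuI := by
  obtain ⟨b, hb, hb'⟩ := dom_int hω0 hTM hf σ ‖x‖
  exact hb.mono' (sf_meas hf σ x) (Eventually.of_forall fun t => hb' t x le_rfl)

lemma Phi'_apply (hω0 : 0 < ω) (hTM : TMprop ω) (hf : HypH f) (σ : V →ₗ[ℝ] XS) (x v : V) :
    Phi' f σ x v = inner ℝ x v / (2 * π) - ∫ t, f ((σ x : ℝ → ℝ) t) * (σ v : ℝ → ℝ) t ∂nuI := by
  unfold Phi'
  rw [ContinuousLinearMap.sub_apply, ContinuousLinearMap.integral_apply (sf_int hω0 hTM hf σ x)]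
  simp [Lt_apply]; ring

lemma sig_cont (σ : V →ₗ[ℝ] XS) (t : ℝ) : Continuous fun x : V => (σ x : ℝ → ℝ) t := by
  simp_rw [← Lt_apply]; exact (Lt σ t).continuous

lemma Phi_deriv (hω0 : 0 < ω) (hTM : TMprop ω) (hf : HypH f) (σ : V →ₗ[ℝ] XS) (x : V) :
    HasFDerivAt (Phi f σ) (Phi' f σ x) x := by
  unfold Phi Phi'
  refine HasFDerivAt.sub ?_ ?_
  · have h := (hasStrictFDerivAt_norm_sq x).hasFDerivAt.const_mul ((4 * π)⁻¹)
    have e : (2 * π)⁻¹ • innerSL ℝ x = (4 * π)⁻¹ • (2 • innerSL ℝ x) := by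
      ext v; simp; ring
    rw [e]
    refine h.congr_of_eventuallyEq (Eventually.of_forall fun y => ?_)
    simp only [div_eq_inv_mul]
  · obtain ⟨b, hb, hb'⟩ := dom_int hω0 hTM hf σ (‖x‖ + 1)
    refine hasFDerivAt_integral_of_dominated_of_fderiv_le (bound := b) (s := Metric.ball x 1)
      (F' := fun y t => f ((σ y : ℝ → ℝ) t) • Lt σ t)
      (Metric.ball_mem_nhds x one_pos) (Eventually.of_forall fun y => ?_) ?_ (sf_meas hf σ x) ?_ hb ?_
    · exact (F_int hω0 hTM hf (σ y).2).aestronglyMeasurable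
    · exact F_int hω0 hTM hf (σ x).2
    · refine Eventually.of_forall fun t y hy => hb' t y ?_
      rw [Metric.mem_ball, dist_eq_norm] at hy
      linarith [norm_le_norm_add_norm_sub' y x]
    · refine Eventually.of_forall fun t y _ => ?_
      have h1 := (hasDerivAt_F hf.1 ((σ y : ℝ → ℝ) t)).comp_hasFDerivAt y
        (f := fun z => (σ z : ℝ → ℝ) t) (f' := Lt σ t) (by
          simp_rw [← Lt_apply]; exact (Lt σ t).hasFDerivAt)
      exact h1

lemma Phi'_cont (hω0 : 0 < ω) (hTM : TMprop ω) (hf : HypH f) (σ : V →ₗ[ℝ] XS) :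
    Continuous (Phi' f σ) := by
  unfold Phi'
  have h0 : Continuous fun x : V => (2 * π)⁻¹ • innerSL ℝ x := by
    have h00 : Continuous fun x : V => innerSL ℝ x := (innerSL ℝ).continuous
    exact h00.const_smul ((2 * π)⁻¹ : ℝ)
  refine Continuous.sub h0 ?_
  rw [continuous_iff_continuousAt]
  intro x
  obtain ⟨b, hb, hb'⟩ := dom_int hω0 hTM hf σ (‖x‖ + 1)
  refine continuousAt_of_dominated (bound := b) (Eventually.of_forall fun y => sf_meas hf σ y) ?_ hb ?_
  · filter_upwards [Metric.ball_mem_nhds x one_pos] with y hy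
    refine Eventually.of_forall fun t => hb' t y ?_
    rw [Metric.mem_ball, dist_eq_norm] at hy
    linarith [norm_le_norm_add_norm_sub' y x]
  · refine Eventually.of_forall fun t => ?_
    exact ((hf.1.comp (sig_cont σ t)).smul continuous_const).continuousAt

lemma Phi_even (hodd : ∀ t : ℝ, f (-t) = -f t) (σ : V →ₗ[ℝ] XS) (x : V) :
    Phi f σ (-x) = Phi f σ x := by
  unfold Phi; simp [F_even hodd]

lemma coercive (hω0 : 0 < ω) (hTM : TMprop ω) (hf : HypH f) (hodd : ∀ t : ℝ, f (-t) = -f t)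
    (σ : V →ₗ[ℝ] XS) (hσ : ∀ x, gagSq (σ x : ℝ → ℝ) = ‖x‖^2) :
    ∃ B : ℝ, ∀ x, Phi f σ x ≤ B - ‖x‖^2 := by
  -- injection into L2
  let T : V →ₗ[ℝ] Lp ℝ 2 nuI :=
    { toFun := fun x => (memX.memI (σ x).2).toLp _
      map_add' := fun x y => by
        rw [← MemLp.toLp_add]
        exact MemLp.toLp_congr _ _ (by rw [map_add]; rfl)
      map_smul' := fun c x => by
        rw [RingHom.id_apply, ← MemLp.toLp_const_smul]
        exact MemLp.toLp_congr _ _ (by rw [map_smul]; rfl) }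
  have hTn : ∀ x, ‖T x‖^2 = ∫ t, ((σ x : ℝ → ℝ) t)^2 ∂nuI := by
    intro x
    rw [← real_inner_self_eq_norm_sq, L2.inner_def]
    apply integral_congr_ae
    filter_upwards [(memX.memI (σ x).2).coeFn_toLp] with p h1
    show inner ℝ ((T x) p) ((T x) p) = _
    simp only [T, LinearMap.coe_mk, AddHom.coe_mk]
    rw [h1]; simp
  have hker : LinearMap.ker T = ⊥ := by
    rw [LinearMap.ker_eq_bot']
    intro x hx
    have h1 := hTn x
    rw [hx, norm_zero] at h1
    have h2 : ∫ t, ((σ x : ℝ → ℝ) t)^2 ∂nuI = 0 := by rw [← h1]; norm_num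
    rw [integral_eq_zero_iff_of_nonneg (fun x => sq_nonneg _) (memX.intsq (σ x).2)] at h2
    have h3 := (ae_restrict_iff' measurableSet_Ioo).1 h2
    have h4 : (σ x : ℝ → ℝ) =ᵐ[volume] 0 := by
      filter_upwards [h3, (σ x).2.2] with t h4 h5
      by_cases ht : t ∈ Ioo (0:ℝ) 1
      · simpa using h4 ht
      · exact h5 ht
    have h5 := gagSq_congr h4
    rw [hσ] at h5
    have h6 : gagSq (0 : ℝ → ℝ) = 0 := by simp [gagSq, gagKer]
    rw [h6] at h5
    simpa using h5
  obtain ⟨K, hK, hanti⟩ := T.exists_antilipschitzWith hker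
  have hlow : ∀ x, ‖x‖ ≤ K * ‖T x‖ := fun x => by
    have := hanti.le_mul_dist x 0
    simpa using this
  have hK' : (0:ℝ) < K := by exact_mod_cast hK
  set A : ℝ := (1/(4*π) + 1) * K^2 with hA
  have hA0 : 0 ≤ A := by positivity
  obtain ⟨B, hB⟩ := superquad hf hodd A
  refine ⟨B, fun x => ?_⟩
  have h1 : A * (∫ t, ((σ x : ℝ → ℝ) t)^2 ∂nuI) - B ≤ ∫ t, primF f ((σ x : ℝ → ℝ) t) ∂nuI := by
    have hi := (memX.intsq (σ x).2).const_mul A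
    have := integral_mono (μ := nuI) (hi.sub (integrable_const B)) (F_int hω0 hTM hf (σ x).2)
      (fun t => hB _)
    simp only [Pi.sub_apply] at this
    rw [integral_sub hi (integrable_const B), integral_const_mul] at this
    simpa using this
  rw [← hTn] at h1
  have h2 : (1/(4*π) + 1) * ‖x‖^2 ≤ A * ‖T x‖^2 := by
    have := pow_le_pow_left₀ (norm_nonneg _) (hlow x) 2
    rw [mul_pow] at this
    rw [hA, mul_assoc]
    exact mul_le_mul_of_nonneg_left this (by positivity)
  unfold Phi
  have e : ‖x‖^2 / (4*π) = 1/(4*π) * ‖x‖^2 := by ring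
  rw [e]
  linarith
end
end BU

namespace BU
variable {ω : ℝ} {f : ℝ → ℝ}

lemma lower (hω0 : 0 < ω) (hTM : TMprop ω) (hf : HypH f) {ρ : ℝ} (hρ : 0 < ρ) :
    ∃ n : ℕ, 0 < n ∧ ∀ u, memX u → gagSq u = ρ^2 → (∀ k < n, av n k u = 0) →
      ρ^2/(8*π) ≤ ρ^2/(4*π) - ∫ x, primF f (u x) ∂nuI := by
  obtain ⟨C, hC, h⟩ := f_bound hω0 hTM hf hρ
  obtain ⟨n, hn⟩ := exists_nat_gt (C * ρ^2 / (ρ^2/(4*π))^2)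
  have hpos : (0:ℝ) < ρ^2/(4*π) := by positivity
  have hn0 : (0:ℝ) < n := lt_of_le_of_lt (by positivity) hn
  refine ⟨n, by exact_mod_cast hn0, fun u hu hg hav => ?_⟩
  obtain ⟨h1, h2⟩ := h u hu hg.le
  have h3 := averaging hu n (by exact_mod_cast hn0)
  rw [Finset.sum_eq_zero (fun k hk => by rw [hav k (Finset.mem_range.1 hk)]; simp), mul_zero, zero_add, hg] at h3
  have h4 := F_int_le hω0 hTM hf hu
  have h5 := (le_abs_self _).trans (cs h1 hu.memI)
  have h6 : √(∫ x, f (u x) ^2 ∂nuI) * √(∫ x, u x ^ 2 ∂nuI) ≤ ρ^2/(4*π) := by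
    rw [← Real.sqrt_mul (integral_nonneg fun x => sq_nonneg _)]
    rw [Real.sqrt_le_left hpos.le]
    have : (∫ x, f (u x) ^2 ∂nuI) * (∫ x, u x ^ 2 ∂nuI) ≤ C * ((n:ℝ)⁻¹ * ρ^2) :=
      mul_le_mul h2 h3 (integral_nonneg fun x => sq_nonneg _) hC
    refine this.trans ?_
    rw [div_lt_iff₀ (by positivity)] at hn
    rw [mul_left_comm, inv_mul_le_iff₀ hn0]
    exact hn.le
  have e : ρ^2/(4*π) = 2 * (ρ^2/(8*π)) := by field_simp; ring
  linarith

def avL (n k : ℕ) : XS →ₗ[ℝ] ℝ where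
  toFun u := av n k u
  map_add' u v := by
    have h : ∀ w : XS, Integrable (w : ℝ → ℝ) (volume.restrict (Ioc ((k:ℝ)/n) (((k:ℝ)+1)/n))) := fun w =>
      ((memX.memLp w.2).restrict _).integrable (by norm_num)
    exact integral_add (h u) (h v)
  map_smul' c u := integral_const_mul _ _

section gen
variable {R : Type*} [NormedAddCommGroup R] [InnerProductSpace ℝ R]
def En (f : ℝ → ℝ) (sg : R →ₗ[ℝ] XS) (x : R) : ℝ := ‖x‖^2 / (4 * π) - ∫ t, primF f ((sg x : ℝ → ℝ) t) ∂nuI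

lemma coerciveS (hω0 : 0 < ω) (hTM : TMprop ω) (hf : HypH f) (hodd : ∀ t : ℝ, f (-t) = -f t)
    (sg : R →ₗ[ℝ] XS) (sg_norm : ∀ x, gagSq (sg x : ℝ → ℝ) = ‖x‖^2)
    (S : Submodule ℝ R) (hS : FiniteDimensional ℝ S) : ∃ B : ℝ, ∀ x ∈ S, En f sg x ≤ B := by
  let τ : S →ₗ[ℝ] XS := sg ∘ₗ S.subtype
  have hτ : ∀ x, gagSq (τ x : ℝ → ℝ) = ‖x‖^2 := fun x => by
    simp only [τ]; rw [LinearMap.comp_apply, sg_norm]; rfl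
  obtain ⟨B, hB⟩ := coercive hω0 hTM hf hodd τ hτ
  refine ⟨B, fun x hx => ?_⟩
  have := hB ⟨x, hx⟩
  refine le_trans (le_of_eq ?_) (this.trans (by linarith [sq_nonneg ‖(⟨x, hx⟩ : S)‖]))
  rfl

lemma galerkin (hω0 : 0 < ω) (hTM : TMprop ω) (hf : HypH f) (hodd : ∀ t : ℝ, f (-t) = -f t)
    (sg : R →ₗ[ℝ] XS) (sg_norm : ∀ x, gagSq (sg x : ℝ → ℝ) = ‖x‖^2)
    (W0 : ℕ → Submodule ℝ R) (W0_fin : ∀ m, FiniteDimensional ℝ (W0 m)) (W0_rank : ∀ m, Module.finrank ℝ (W0 m) = m)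
    {ρ : ℝ} (hρ : 0 < ρ) :
    ∃ m : ℕ, ∃ β : ℝ, 0 < β ∧ ∀ S : Submodule ℝ R, FiniteDimensional ℝ S → W0 m ≤ S →
      ∃ x ∈ S, (∀ v ∈ S, inner ℝ x v / (2*π) =
        ∫ t, f ((sg x : ℝ → ℝ) t) * (sg v : ℝ → ℝ) t ∂nuI) ∧
        ρ^2/(8*π)/2 ≤ En f sg x ∧ En f sg x ≤ β + 1 := by
  obtain ⟨n, hn, hlow⟩ := lower hω0 hTM hf hρ
  obtain ⟨B, hB⟩ := coerciveS hω0 hTM hf hodd sg sg_norm (W0 (n+1)) (W0_fin _)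
  have hα : 0 < ρ^2/(8*π) := by positivity
  refine ⟨n+1, max B (ρ^2/(8*π)), lt_max_of_lt_right hα, fun S hS hWS => ?_⟩
  let τ : S →ₗ[ℝ] XS := sg ∘ₗ S.subtype
  have hτ : ∀ x, gagSq (τ x : ℝ → ℝ) = ‖x‖^2 := fun x => by
    simp only [τ]; rw [LinearMap.comp_apply, sg_norm]; rfl
  obtain ⟨B', hB'⟩ := coercive hω0 hTM hf hodd τ hτ
  let A : S →ₗ[ℝ] (Fin n → ℝ) := LinearMap.pi fun k => avL n k ∘ₗ τ
  have hrk : Module.finrank ℝ S ≤ Module.finrank ℝ (LinearMap.ker A) + n := by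
    have h1 := A.finrank_range_add_finrank_ker
    have h2 := Submodule.finrank_le (LinearMap.range A)
    simp at h2
    omega
  obtain ⟨x, hx1, hx2, hx3⟩ := minimax (Phi f τ) (Phi' f τ) (Phi_deriv hω0 hTM hf τ)
    (Phi'_cont hω0 hTM hf τ) (Phi_even hodd τ) (LinearMap.ker A) ((W0 (n+1)).comap S.subtype)
    (by
      have : Module.finrank ℝ ((W0 (n+1)).comap S.subtype) = n + 1 := by
        rw [(Submodule.comapSubtypeEquivOfLe hWS).finrank_eq, W0_rank]
      omega) ρ (ρ^2/(8*π)) (max B (ρ^2/(8*π))) hρ hα (le_max_right _ _)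
    (by
      refine (Metric.isBounded_closedBall (x := 0) (r := √(max B' 0))).subset ?_
      intro x hx
      rw [mem_closedBall_zero_iff]
      apply Real.le_sqrt_of_sq_le
      have h1 := hB' x
      have h2 : ρ^2/(8*π)/2 ≤ Phi f τ x := hx
      linarith [le_max_left B' 0])
    (by
      intro x hx hxn
      have := hlow (τ x) (τ x).2 (by rw [hτ, hxn]) (fun k hk => by
        have := congrFun (LinearMap.mem_ker.1 hx) ⟨k, hk⟩
        exact this)
      unfold Phi
      rw [hxn]; exact this)
    (by
      intro x hx
      exact (hB x hx).trans (le_max_left _ _))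
  refine ⟨x, x.2, fun v hv => ?_, hx2, hx3⟩
  have h1 := Phi'_apply hω0 hTM hf τ x ⟨v, hv⟩
  rw [hx1, ContinuousLinearMap.zero_apply] at h1
  exact (sub_eq_zero.1 h1.symm)

end gen

abbrev RR := LinearMap.range DD

instance : TopologicalSpace.SeparableSpace RR := by
  have h : Fact ((2:ENNReal) ≠ ⊤) := ⟨by norm_num⟩
  have h0 : IsSeparable (volume : Measure (ℝ × ℝ)) := inferInstance
  have h1 : SecondCountableTopology HH := Lp.SecondCountableTopology
  have h2 : SecondCountableTopology RR := TopologicalSpace.Subtype.secondCountableTopology _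
  exact TopologicalSpace.SecondCountableTopology.to_separableSpace

lemma exists_sec : ∃ σ : RR →ₗ[ℝ] XS, ∀ x, DD (σ x) = (x : HH) := by
  obtain ⟨σ, hσ⟩ := DD.rangeRestrict.exists_rightInverse_of_surjective DD.range_rangeRestrict
  refine ⟨σ, fun x => ?_⟩
  have := LinearMap.congr_fun hσ x
  exact congrArg Subtype.val this

def sg : RR →ₗ[ℝ] XS := exists_sec.choose
lemma sg_spec (x : RR) : DD (sg x) = (x : HH) := exists_sec.choose_spec x

lemma sg_inner (x y : RR) : innerX (sg x : ℝ → ℝ) (sg y) = inner ℝ x y := by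
  rw [← DD_inner, sg_spec, sg_spec]; rfl

lemma sg_norm (x : RR) : gagSq (sg x : ℝ → ℝ) = ‖x‖^2 := by
  rw [← innerX_self, sg_inner, real_inner_self_eq_norm_sq]

def wt (m : ℕ) (i : Fin m) : RR := ⟨DD ⟨tent m i, tent_memX i.2⟩, ⟨_, rfl⟩⟩
lemma wt_indep (m : ℕ) : LinearIndependent ℝ (wt m) :=
  LinearIndependent.of_comp RR.subtype (tent_indep m)

def W0 (m : ℕ) : Submodule ℝ RR := Submodule.span ℝ (range (wt m))
instance (m : ℕ) : FiniteDimensional ℝ (W0 m) := FiniteDimensional.span_of_finite ℝ (finite_range _)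
lemma W0_rank (m : ℕ) : Module.finrank ℝ (W0 m) = m := by
  unfold W0
  rw [finrank_span_eq_card (wt_indep m)]; simp

theorem approx (hω0 : 0 < ω) (hTM : TMprop ω) (hf : HypH f) (hodd : ∀ t : ℝ, f (-t) = -f t)
    {ρ : ℝ} (hρ : 0 < ρ) :
    ∃ Γ > (0:ℝ), ∃ u : ℕ → ℝ → ℝ, ∃ e : ℕ → ℝ → ℝ, (∀ N, memX (u N)) ∧ (∀ N, gagSq (u N) ≤ Γ^2) ∧
      (∀ N, ρ^2/(8*π) ≤ ∫ x, f (u N x) * u N x ∂nuI) ∧ (∀ i, memX (e i)) ∧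
      (∀ v, memX v → ∀ ε > 0, ∃ i, √(gagSq (v - e i)) < ε) ∧
      ∀ i N, i ≤ N → innerX (u N) (e i) / (2*π) = ∫ x, f (u N x) * e i x ∂nuI := by
  obtain ⟨m, β, hβ, hS⟩ := galerkin hω0 hTM hf hodd sg sg_norm W0 inferInstance W0_rank hρ
  obtain ⟨B, hB0, hB⟩ := AR hf
  let d : ℕ → RR := TopologicalSpace.denseSeq RR
  let S : ℕ → Submodule ℝ RR := fun N => W0 m ⊔ Submodule.span ℝ (d '' Iic N)
  have hSf : ∀ N, FiniteDimensional ℝ (S N) := fun N => by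
    have : FiniteDimensional ℝ (Submodule.span ℝ (d '' Iic N)) :=
      FiniteDimensional.span_of_finite ℝ ((finite_Iic N).image d)
    exact Submodule.finiteDimensional_sup _ _
  choose x hxS hcrit hlo hhi using fun N => hS (S N) (hSf N) le_sup_left
  set G := 8 * π * (β + 1 + B/4) with hG
  have hG0 : 0 < G := by positivity
  have hself : ∀ N, ‖x N‖^2 / (2*π) = ∫ t, f ((sg (x N) : ℝ → ℝ) t) * (sg (x N) : ℝ → ℝ) t ∂nuI := by
    intro N
    rw [← hcrit N (x N) (hxS N), real_inner_self_eq_norm_sq]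
  refine ⟨√G, Real.sqrt_pos.2 hG0, fun N => sg (x N), fun i => sg (d i), fun N => (sg (x N)).2, ?_, ?_,
    fun i => (sg (d i)).2, ?_, ?_⟩
  · intro N
    rw [Real.sq_sqrt hG0.le, sg_norm]
    have h1 := hhi N
    have h3 : Integrable (fun t => f ((sg (x N) : ℝ → ℝ) t) * (sg (x N) : ℝ → ℝ) t) nuI :=
      (f_mem hω0 hTM hf (sg (x N)).2).integrable_mul (memX.memI (sg (x N)).2)
    have h2 : 4 * ∫ t, primF f ((sg (x N) : ℝ → ℝ) t) ∂nuI ≤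
        (∫ t, f ((sg (x N) : ℝ → ℝ) t) * (sg (x N) : ℝ → ℝ) t ∂nuI) + B := by
      rw [← integral_const_mul]
      refine (integral_mono ((F_int hω0 hTM hf (sg (x N)).2).const_mul 4) (h3.add (integrable_const B))
        (fun t => hB _)).trans (le_of_eq ?_)
      simp only [Pi.add_apply]
      rw [integral_add h3 (integrable_const B)]; simp
    unfold En at h1
    rw [← hself] at h2
    have e1 : ‖x N‖^2 / (4*π) = 2 * (‖x N‖^2 / (8*π)) := by field_simp; ring
    have e2 : ‖x N‖^2 / (2*π) = 4 * (‖x N‖^2 / (8*π)) := by field_simp; ring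
    rw [e1] at h1; rw [e2] at h2
    have : ‖x N‖^2 / (8*π) ≤ β + 1 + B/4 := by linarith
    rw [div_le_iff₀ (by positivity)] at this
    rw [hG]; linarith
  · intro N
    rw [← hself]
    have h1 := hlo N
    unfold En at h1
    have h2 : 0 ≤ ∫ t, primF f ((sg (x N) : ℝ → ℝ) t) ∂nuI := integral_nonneg fun t => F_nonneg hf _
    have e1 : ‖x N‖^2 / (2*π) = 2 * (‖x N‖^2 / (4*π)) := by field_simp; ring
    rw [e1]; linarith
  · intro v hv ε hε
    obtain ⟨i, hi⟩ := (TopologicalSpace.denseRange_denseSeq RR).exists_dist_lt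
      (⟨DD ⟨v, hv⟩, ⟨_, rfl⟩⟩ : RR) hε
    refine ⟨i, ?_⟩
    have : gagSq (v - (sg (d i) : ℝ → ℝ)) = (dist (⟨DD ⟨v, hv⟩, ⟨_, rfl⟩⟩ : RR) (d i))^2 := by
      have h1 := DD_norm (⟨v, hv⟩ - sg (d i))
      rw [map_sub, sg_spec] at h1
      rw [dist_eq_norm]
      exact h1.symm
    rw [this, Real.sqrt_sq dist_nonneg]
    exact hi
  · intro i N hiN
    rw [sg_inner]
    exact hcrit N (d i) (Submodule.mem_sup_right (Submodule.subset_span ⟨i, hiN, rfl⟩))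
end BU

namespace BU

lemma lemW {α : Type*} [MeasurableSpace α] {μ : Measure α} {g : ℕ → α → ℝ} {h : α → ℝ} {C : ℝ}
    (hg : ∀ j, MemLp (g j) 2 μ) (hC : ∀ j, ∫ x, g j x ^ 2 ∂μ ≤ C) (hh : MemLp h 2 μ)
    (hae : ∀ᵐ x ∂μ, Tendsto (fun j => g j x) atTop (𝓝 0)) :
    Tendsto (fun j => ∫ x, g j x * h x ∂μ) atTop (𝓝 0) := by
  have hC0 : 0 ≤ C := (integral_nonneg fun x => sq_nonneg _).trans (hC 0)
  rw [Metric.tendsto_atTop]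
  intro ε hε
  set δ := ε / (2 * (C + 1)) with hδ
  have hδ0 : 0 < δ := by positivity
  have hint : ∀ j, Integrable (fun x => g j x * h x) μ := fun j => (hg j).integrable_mul hh
  have hsq : ∀ j, Integrable (fun x => g j x ^ 2) μ := fun j => (hg j).integrable_sq
  set D : ℕ → α → ℝ := fun j x => max (|g j x * h x| - δ * g j x ^ 2) 0 with hD
  have hb : ∀ j x, D j x ≤ h x ^ 2 / (4 * δ) := by
    intro j x
    refine max_le ?_ (by positivity)
    rw [le_div_iff₀ (by positivity), abs_mul, ← sq_abs (g j x), ← sq_abs (h x)]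
    nlinarith [sq_nonneg (2 * δ * |g j x| - |h x|)]
  have hDint : ∀ j, Integrable (D j) μ := fun j =>
    ((hint j).abs.sub ((hsq j).const_mul δ)).sup (integrable_zero _ _ _)
  have hlim : Tendsto (fun j => ∫ x, D j x ∂μ) atTop (𝓝 0) := by
    have : Tendsto (fun j => ∫ x, D j x ∂μ) atTop (𝓝 (∫ x, (0:ℝ) ∂μ)) := by
      refine tendsto_integral_of_dominated_convergence (fun x => h x ^ 2 / (4 * δ))
        (fun j => (hDint j).aestronglyMeasurable) (hh.integrable_sq.div_const _)
        (fun j => Eventually.of_forall fun x => ?_) ?_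
      · rw [Real.norm_eq_abs, abs_of_nonneg (le_max_right _ _)]; exact hb j x
      · filter_upwards [hae] with x hx
        have h1 : Tendsto (fun j => max (|g j x * h x| - δ * g j x ^ 2) 0) atTop
            (𝓝 (max (|0 * h x| - δ * 0 ^ 2) 0)) :=
          (((hx.mul_const _).abs).sub ((hx.pow 2).const_mul δ)).max tendsto_const_nhds
        have e : max (|0 * h x| - δ * 0 ^ 2) 0 = 0 := by simp
        rw [e] at h1
        exact h1
    simpa using this
  obtain ⟨N, hN⟩ := Metric.tendsto_atTop.1 hlim (ε/2) (by positivity)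
  refine ⟨N, fun j hj => ?_⟩
  have h1 := hN j hj
  rw [Real.dist_eq, sub_zero] at h1 ⊢
  have h2 : |∫ x, g j x * h x ∂μ| ≤ ∫ x, D j x + δ * g j x ^ 2 ∂μ := by
    refine (abs_integral_le_integral_abs).trans ?_
    refine integral_mono (hint j).abs ((hDint j).add ((hsq j).const_mul δ)) fun x => ?_
    have := le_max_left (|g j x * h x| - δ * g j x ^ 2) 0
    simp only [hD]; linarith
  rw [integral_add (hDint j) ((hsq j).const_mul δ), integral_const_mul] at h2
  have h3 : δ * ∫ x, g j x ^ 2 ∂μ ≤ δ * C := mul_le_mul_of_nonneg_left (hC j) hδ0.le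
  have h4 : δ * C < ε / 2 := by
    rw [hδ, div_mul_eq_mul_div, div_lt_div_iff₀ (by positivity) (by positivity)]
    nlinarith
  have := le_abs_self (∫ x, D j x ∂μ)
  linarith

lemma sqrt_gag (u : XS) : √(gagSq u) = ‖DD u‖ := by
  rw [← DD_norm, Real.sqrt_sq (norm_nonneg _)]

lemma gag_sub {u v : ℝ → ℝ} (hu : memX u) (hv : memX v) : √(gagSq (u - v)) ≤ √(gagSq u) + √(gagSq v) := by
  have h := norm_sub_le (DD ⟨u, hu⟩) (DD ⟨v, hv⟩)
  rw [← map_sub, ← sqrt_gag, ← sqrt_gag, ← sqrt_gag] at h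
  exact h

lemma gag_sub_sq {u v : ℝ → ℝ} (hu : memX u) (hv : memX v) {A B : ℝ} (hA : 0 ≤ A) (hB : 0 ≤ B)
    (h1 : gagSq u ≤ A^2) (h2 : gagSq v ≤ B^2) : gagSq (u - v) ≤ (A + B)^2 := by
  have h := gag_sub hu hv
  have h3 : √(gagSq u) ≤ A := Real.sqrt_le_iff.2 ⟨hA, h1⟩
  have h4 : √(gagSq v) ≤ B := Real.sqrt_le_iff.2 ⟨hB, h2⟩
  exact (Real.sqrt_le_left (by positivity)).1 (by linarith)

lemma normI {g : ℝ → ℝ} (hg : MemLp g 2 nuI) : ‖hg.toLp g‖^2 = ∫ x, g x ^ 2 ∂nuI := by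
  rw [← real_inner_self_eq_norm_sq, L2.inner_def]
  apply integral_congr_ae
  filter_upwards [hg.coeFn_toLp] with x hx
  rw [hx]; simp [sq]

lemma av_sub {u v : ℝ → ℝ} (hu : memX u) (hv : memX v) (n k : ℕ) : av n k (u - v) = av n k u - av n k v :=
  (avL n k).map_sub ⟨u, hu⟩ ⟨v, hv⟩

lemma int_sq_vol {u : ℝ → ℝ} (hu : memX u) : ∫ x, u x ^ 2 = ∫ x, u x ^ 2 ∂nuI := by
  symm
  apply setIntegral_eq_integral_of_ae_compl_eq_zero
  filter_upwards [hu.2] with x hx h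
  simp [hx h]

lemma av_bound {u : ℝ → ℝ} (hu : memX u) {A : ℝ} (h : gagSq u ≤ A) (n k : ℕ) :
    |av n k u| ≤ volume.real (Ioc ((k:ℝ)/n) (((k:ℝ)+1)/n)) + 4 * A := by
  unfold av
  have h1 : Integrable u (volume.restrict (Ioc ((k:ℝ)/n) (((k:ℝ)+1)/n))) :=
    (hu.memLp.restrict _).integrable (by norm_num)
  have h2 : Integrable (fun x => u x ^ 2) volume := hu.memLp.integrable_sq
  refine abs_integral_le_integral_abs.trans ?_
  refine (integral_mono h1.abs ((integrable_const (1:ℝ)).add h2.restrict)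
    (fun x => ?_)).trans ?_
  · change |u x| ≤ 1 + u x ^ 2
    nlinarith [sq_nonneg (|u x| - 1), sq_abs (u x), abs_nonneg (u x)]
  · rw [integral_add' (integrable_const _) h2.restrict]
    have h3 : ∫ x in Ioc ((k:ℝ)/n) (((k:ℝ)+1)/n), u x ^ 2 ≤ ∫ x, u x ^ 2 :=
      setIntegral_le_integral h2 (Eventually.of_forall fun x => sq_nonneg _)
    rw [int_sq_vol hu] at h3
    have := poincare hu
    simp
    linarith

lemma compactX {u : ℕ → ℝ → ℝ} (hu : ∀ N, memX (u N)) {Γ : ℝ} (hΓ0 : 0 < Γ) (hΓ : ∀ N, gagSq (u N) ≤ Γ^2) :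
    ∃ φ : ℕ → ℕ, StrictMono φ ∧ ∃ w, memX w ∧ (∀ᵐ x, Tendsto (fun N => u (φ N) x) atTop (𝓝 (w x))) ∧
      Tendsto (fun N => ∫ x, (u (φ N) x - w x)^2 ∂nuI) atTop (𝓝 0) := by
  -- step 1: averages
  let M : ℕ × ℕ → ℝ := fun q => volume.real (Ioc ((q.2:ℝ)/q.1) (((q.2:ℝ)+1)/q.1)) + 4 * Γ^2
  have hK : IsCompact (Set.pi univ fun q => Icc (-(M q)) (M q)) := isCompact_univ_pi fun q => isCompact_Icc
  obtain ⟨a, -, φ, hφ, ha⟩ := hK.tendsto_subseq (x := fun N q => av q.1 q.2 (u N)) (fun N q _ =>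
    abs_le.1 (av_bound (hu N) (hΓ N) q.1 q.2))
  rw [tendsto_pi_nhds] at ha
  -- step 2: Cauchy
  have hcau : CauchySeq (fun N => (hu (φ N)).memI.toLp (u (φ N))) := by
    rw [Metric.cauchySeq_iff']
    intro ε hε
    obtain ⟨n, hn⟩ := exists_nat_gt ((Γ+Γ)^2 / (ε^2/2))
    have hn0 : (0:ℝ) < n := lt_of_le_of_lt (by positivity) hn
    have hn0' : 0 < n := by exact_mod_cast hn0
    have hsum : ∃ N0, ∀ N ≥ N0, (n:ℝ) * ∑ k ∈ Finset.range n, (av n k (u (φ N)) - av n k (u (φ N0)))^2 < ε^2/2 := by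
      have hc : CauchySeq (fun N => fun k : Fin n => av n k (u (φ N))) := by
        apply Tendsto.cauchySeq (x := fun k : Fin n => a (n, k))
        rw [tendsto_pi_nhds]
        intro k
        exact ha (n, k)
      obtain ⟨N0, h0⟩ := Metric.cauchySeq_iff'.1 hc (ε / (2 * n)) (by positivity)
      refine ⟨N0, fun N hN => ?_⟩
      have h1 := h0 N hN
      rw [dist_pi_lt_iff (by positivity)] at h1
      have h2 : ∑ k ∈ Finset.range n, (av n k (u (φ N)) - av n k (u (φ N0)))^2
          ≤ ∑ k ∈ Finset.range n, (ε / (2*n))^2 := by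
        refine Finset.sum_le_sum fun k hk => ?_
        have := h1 ⟨k, Finset.mem_range.1 hk⟩
        rw [Real.dist_eq] at this
        exact sq_le_sq' (by linarith [(abs_lt.1 this).1]) (abs_lt.1 this).2.le
      rw [Finset.sum_const, Finset.card_range, nsmul_eq_mul] at h2
      have h3 := mul_le_mul_of_nonneg_left h2 hn0.le
      refine h3.trans_lt ?_
      have : (n:ℝ) * (n * (ε / (2*n))^2) = ε^2/4 := by field_simp; ring
      rw [this]; nlinarith [sq_pos_of_pos hε]
    obtain ⟨N0, h0⟩ := hsum
    refine ⟨N0, fun N hN => ?_⟩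
    have h1 := averaging ((hu (φ N)).sub (hu (φ N0))) n hn0'
    simp only [av_sub (hu (φ N)) (hu (φ N0))] at h1
    have h2 := gag_sub_sq (hu (φ N)) (hu (φ N0)) hΓ0.le hΓ0.le (hΓ _) (hΓ _)
    have h3 : (n:ℝ)⁻¹ * gagSq (u (φ N) - u (φ N0)) < ε^2/2 := by
      refine (mul_le_mul_of_nonneg_left h2 (by positivity)).trans_lt ?_
      rw [inv_mul_lt_iff₀ hn0]
      rwa [div_lt_iff₀ (by positivity)] at hn
    rw [dist_eq_norm, ← MemLp.toLp_sub]
    refine lt_of_pow_lt_pow_left₀ 2 hε.le ?_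
    rw [normI]
    have := h0 N hN
    linarith
  obtain ⟨g, hgl⟩ := cauchySeq_tendsto_of_complete hcau
  obtain ⟨ψ, hψ, hae⟩ := (tendstoInMeasure_of_tendsto_Lp hgl).exists_seq_tendsto_ae
  have hgm : Measurable g := (Lp.stronglyMeasurable g).measurable
  set w : ℝ → ℝ := (Ioo (0:ℝ) 1).indicator g with hw
  have hwm : Measurable w := hgm.indicator measurableSet_Ioo
  have hwg : w =ᵐ[nuI] g := indicator_ae_eq_restrict measurableSet_Ioo
  have hwL : MemLp w 2 volume := (memLp_indicator_iff_restrict measurableSet_Ioo).2 (Lp.memLp g)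
  have haeI : ∀ᵐ x ∂nuI, Tendsto (fun N => u (φ (ψ N)) x) atTop (𝓝 (w x)) := by
    have : ∀ᵐ x ∂nuI, ∀ N, (hu (φ N)).memI.toLp (u (φ N)) x = u (φ N) x :=
      ae_all_iff.2 fun N => (hu (φ N)).memI.coeFn_toLp
    filter_upwards [hae, this, hwg] with x h1 h2 h3
    rw [h3]
    simpa only [h2] using h1
  have haeV : ∀ᵐ x, Tendsto (fun N => u (φ (ψ N)) x) atTop (𝓝 (w x)) := by
    have h1 := (ae_restrict_iff' measurableSet_Ioo).1 haeI
    have h2 : ∀ᵐ x : ℝ, ∀ N, x ∉ Ioo (0:ℝ) 1 → u N x = 0 := ae_all_iff.2 fun N => (hu N).2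
    filter_upwards [h1, h2] with x h1 h2
    by_cases hx : x ∈ Ioo (0:ℝ) 1
    · exact h1 hx
    · simp only [h2 _ hx, hw, indicator_of_notMem hx]
      exact tendsto_const_nhds
  have hDae : ∀ᵐ p : ℝ × ℝ, Tendsto (fun N => Dk (u (φ (ψ N))) p) atTop (𝓝 (Dk w p)) := by
    filter_upwards [Measure.quasiMeasurePreserving_snd.ae haeV, Measure.quasiMeasurePreserving_fst.ae haeV] with p h1 h2
    exact (h2.sub h1).div_const _
  have hwX : memX w := by
    rw [memX_iff]
    refine ⟨hwm, hwL, ⟨(Dk_meas hwm).aestronglyMeasurable, ?_⟩, Eventually.of_forall fun x hx => indicator_of_notMem hx _⟩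
    refine lt_of_le_of_lt (Lp.eLpNorm_lim_le_liminf_eLpNorm (f := fun N => Dk (u (φ (ψ N))))
      (fun N => (hu _).memD.1) (Dk w) hDae) ?_
    refine lt_of_le_of_lt (b := ENNReal.ofReal Γ) ?_ ENNReal.ofReal_lt_top
    refine liminf_le_of_frequently_le' (Frequently.of_forall fun N => ?_)
    have h1 : ‖DD ⟨_, hu (φ (ψ N))⟩‖ ≤ Γ := by
      rw [← sqrt_gag]; exact Real.sqrt_le_iff.2 ⟨hΓ0.le, hΓ _⟩
    have h2 : ‖DD ⟨_, hu (φ (ψ N))⟩‖ = (eLpNorm (Dk (u (φ (ψ N)))) 2 volume).toReal := Lp.norm_toLp _ (hu (φ (ψ N))).memD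
    rw [h2] at h1
    exact ENNReal.le_ofReal_iff_toReal_le (hu _).memD.2.ne hΓ0.le |>.2 h1
  refine ⟨φ ∘ ψ, hφ.comp hψ, w, hwX, haeV, ?_⟩
  have h1 := (tendsto_iff_norm_sub_tendsto_zero.1 (hgl.comp hψ.tendsto_atTop)).pow 2
  have hgw : g = hwX.memI.toLp w := by
    apply Lp.ext
    filter_upwards [hwg, hwX.memI.coeFn_toLp] with x h1 h2
    rw [h2, h1]
  rw [hgw] at h1
  simp only [Function.comp_apply, ← MemLp.toLp_sub, normI] at h1
  simpa using h1
end BU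

namespace BU
variable {ω : ℝ} {f : ℝ → ℝ}

lemma innerX_sub_left {u v z : ℝ → ℝ} (hu : memX u) (hv : memX v) (hz : memX z) :
    innerX (u - v) z = innerX u z - innerX v z := by
  have h := inner_sub_left (𝕜 := ℝ) (DD ⟨u, hu⟩) (DD ⟨v, hv⟩) (DD ⟨z, hz⟩)
  rw [← map_sub, DD_inner, DD_inner, DD_inner] at h
  exact h

lemma innerX_comm (u v : ℝ → ℝ) : innerX u v = innerX v u := by
  unfold innerX
  congr 1; ext p; rw [← Dk_mul, ← Dk_mul, mul_comm]

lemma imul {g h : ℝ → ℝ} (hg : MemLp g 2 nuI) (hh : MemLp h 2 nuI) : Integrable (fun x => g x * h x) nuI :=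
  hg.integrable_mul hh

lemma exists_sol (hω0 : 0 < ω) (hTM : TMprop ω) (hf : HypH f) (hodd : ∀ t : ℝ, f (-t) = -f t) (K : ℝ) :
    ∃ w, IsWeakSolution f w ∧ K < ∫ x, f (w x) * w x ∂nuI := by
  obtain ⟨ρ, hρ, hρK⟩ : ∃ ρ : ℝ, 0 < ρ ∧ K < ρ^2/(8*π) := by
    refine ⟨8 * π * (|K| + 1), by positivity, ?_⟩
    rw [lt_div_iff₀ (by positivity)]
    have h1 : 1 ≤ 8 * π := by nlinarith [Real.pi_gt_three]
    have h2 := le_abs_self K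
    have h3 := abs_nonneg K
    calc K * (8*π) < (8 * π) * (|K| + 1) := by nlinarith
      _ ≤ (8 * π * (|K| + 1))^2 := by
        have : 1 ≤ 8 * π * (|K| + 1) := by nlinarith
        nlinarith
  obtain ⟨Γ, hΓ0, u', e, hu', hΓ', hq', he, hd, heq'⟩ := approx hω0 hTM hf hodd hρ
  obtain ⟨φ, hφ, w, hw, hae, hL2⟩ := compactX hu' hΓ0 hΓ'
  set u : ℕ → ℝ → ℝ := fun N => u' (φ N) with hudef
  have hu : ∀ N, memX (u N) := fun N => hu' _
  have hΓ : ∀ N, gagSq (u N) ≤ Γ^2 := fun N => hΓ' _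
  have hq : ∀ N, ρ^2/(8*π) ≤ ∫ x, f (u N x) * u N x ∂nuI := fun N => hq' _
  have heq : ∀ i N, i ≤ N → innerX (u N) (e i)/(2*π) = ∫ x, f (u N x) * e i x ∂nuI :=
    fun i N h => heq' i _ (h.trans (hφ.id_le N))
  change ∀ᵐ x, Tendsto (fun N => u N x) atTop (𝓝 (w x)) at hae
  change Tendsto (fun N => ∫ x, (u N x - w x)^2 ∂nuI) atTop (𝓝 0) at hL2
  obtain ⟨C, hC0, hC⟩ := f_bound hω0 hTM hf hΓ0
  have hfw := f_mem hω0 hTM hf hw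
  have hfu := fun N => (hC (u N) (hu N) (hΓ N)).1
  have hfC := fun N => (hC (u N) (hu N) (hΓ N)).2
  -- weak convergence in X
  have hW1 : ∀ v, memX v → Tendsto (fun N => innerX (u N) v) atTop (𝓝 (innerX w v)) := by
    intro v hv
    have h1 : Tendsto (fun N => ∫ p, Dk (u N - w) p * Dk v p) atTop (𝓝 0) := by
      refine lemW (C := (Γ + √(gagSq w))^2) (fun N => ((hu N).sub hw).memD) (fun N => ?_) hv.memD ?_
      · have : ∫ p, Dk (u N - w) p ^ 2 = gagSq (u N - w) := by
          unfold gagSq; congr 1; ext p; exact Dk_sq _ _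
        rw [this]
        exact gag_sub_sq (hu N) hw hΓ0.le (Real.sqrt_nonneg _) (hΓ N) (Real.sq_sqrt (gagSq_nonneg _)).ge
      · filter_upwards [Measure.quasiMeasurePreserving_snd.ae hae, Measure.quasiMeasurePreserving_fst.ae hae] with p h1 h2
        have h3 := ((h2.sub_const (w p.1)).sub (h1.sub_const (w p.2))).div_const |p.1 - p.2|
        simpa [Dk] using h3
    have h2 : ∀ N, ∫ p, Dk (u N - w) p * Dk v p = innerX (u N) v - innerX w v := by
      intro N
      rw [← innerX_sub_left (hu N) hw hv]
      unfold innerX; congr 1; ext p; exact Dk_mul _ _ _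
    simp only [h2] at h1
    simpa using h1.add_const (innerX w v)
  have hW2 : ∀ v, memX v → Tendsto (fun N => ∫ x, f (u N x) * v x ∂nuI) atTop (𝓝 (∫ x, f (w x) * v x ∂nuI)) := by
    intro v hv
    have h1 : Tendsto (fun N => ∫ x, (f (u N x) - f (w x)) * v x ∂nuI) atTop (𝓝 0) := by
      refine lemW (C := 2 * C + 2 * ∫ x, f (w x)^2 ∂nuI) (fun N => (hfu N).sub hfw) (fun N => ?_) hv.memI ?_
      · have : ∫ x, (f (u N x) - f (w x))^2 ∂nuI ≤ ∫ x, (2 * f (u N x)^2 + 2 * f (w x)^2) ∂nuI := by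
          refine integral_mono ((hfu N).sub hfw).integrable_sq
            (((hfu N).integrable_sq.const_mul 2).add (hfw.integrable_sq.const_mul 2)) fun x => ?_
          change (f (u N x) - f (w x))^2 ≤ 2 * f (u N x)^2 + 2 * f (w x)^2
          nlinarith [sq_nonneg (f (u N x) + f (w x))]
        rw [integral_add ((hfu N).integrable_sq.const_mul 2) (hfw.integrable_sq.const_mul 2),
          integral_const_mul, integral_const_mul] at this
        have := hfC N
        linarith
      · filter_upwards [ae_restrict_of_ae hae] with x hx
        have := ((hf.1.tendsto (w x)).comp hx).sub_const (f (w x))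
        simpa using this
    have h2 : ∀ N, ∫ x, (f (u N x) - f (w x)) * v x ∂nuI =
        (∫ x, f (u N x) * v x ∂nuI) - ∫ x, f (w x) * v x ∂nuI := by
      intro N
      rw [← integral_sub (imul (hfu N) hv.memI) (imul hfw hv.memI)]
      congr 1; ext x; ring
    simp only [h2] at h1
    simpa using h1.add_const (∫ x, f (w x) * v x ∂nuI)
  have heqi : ∀ i, innerX w (e i)/(2*π) = ∫ x, f (w x) * e i x ∂nuI := by
    intro i
    refine tendsto_nhds_unique ((hW1 _ (he i)).div_const _) ((hW2 _ (he i)).congr' ?_)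
    filter_upwards [eventually_ge_atTop i] with N hN
    exact (heq i N hN).symm
  refine ⟨w, ⟨hw, fun v hv => ⟨hfw.integrable_mul hv.memI, ?_⟩⟩, ?_⟩
  · -- density
    set A := √(gagSq w)/(2*π) + √(∫ x, f (w x)^2 ∂nuI) * 2 with hA
    have hA0 : 0 ≤ A := by positivity
    have key : ∀ ε > 0, |innerX w v/(2*π) - ∫ x, f (w x) * v x ∂nuI| ≤ A * ε := by
      intro ε hε
      obtain ⟨i, hi⟩ := hd v hv ε hε
      have hz := hv.sub (he i)
      have h1 : innerX w v/(2*π) - ∫ x, f (w x) * v x ∂nuI =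
          innerX w (v - e i)/(2*π) - ∫ x, f (w x) * (v - e i) x ∂nuI := by
        have e1 : innerX w (v - e i) = innerX w v - innerX w (e i) := by
          rw [innerX_comm, innerX_sub_left hv (he i) hw, innerX_comm v, innerX_comm (e i)]
        have e2 : ∫ x, f (w x) * (v - e i) x ∂nuI = (∫ x, f (w x) * v x ∂nuI) - ∫ x, f (w x) * e i x ∂nuI := by
          rw [← integral_sub (imul hfw hv.memI) (imul hfw (he i).memI)]
          congr 1; ext x; simp; ring
        rw [e1, e2, ← heqi i]; ring
      rw [h1]
      have h2 := innerX_le hw hz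
      have h3 := cs hfw hz.memI
      have h4 : √(∫ x, (v - e i) x ^ 2 ∂nuI) ≤ 2 * √(gagSq (v - e i)) := by
        refine Real.sqrt_le_iff.2 ⟨by positivity, ?_⟩
        rw [mul_pow, Real.sq_sqrt (gagSq_nonneg _)]
        have := poincare hz
        linarith
      have h5 : |innerX w (v - e i)/(2*π)| ≤ √(gagSq w)/(2*π) * √(gagSq (v - e i)) := by
        rw [abs_div, abs_of_pos (by positivity : 0 < 2*π), div_mul_eq_mul_div]
        gcongr
      refine (abs_sub _ _).trans ?_
      have h6 : √(∫ x, f (w x)^2 ∂nuI) * √(∫ x, (v - e i) x ^ 2 ∂nuI) ≤ √(∫ x, f (w x)^2 ∂nuI) * (2 * √(gagSq (v - e i))) := by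
        gcongr
      have h7 : A * √(gagSq (v - e i)) ≤ A * ε := mul_le_mul_of_nonneg_left hi.le hA0
      rw [hA, add_mul] at h7
      rw [hA]
      linarith
    have : |innerX w v/(2*π) - ∫ x, f (w x) * v x ∂nuI| ≤ 0 := by
      refine le_of_forall_pos_le_add fun δ hδ => ?_
      refine (key (δ/(A+1)) (by positivity)).trans ?_
      rw [zero_add, mul_div_assoc', div_le_iff₀ (by positivity)]
      nlinarith
    exact sub_eq_zero.1 (abs_nonpos_iff.1 this)
  · have h1 : Tendsto (fun N => ∫ x, f (u N x) * (u N - w) x ∂nuI) atTop (𝓝 0) := by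
      have hs : Tendsto (fun N => √C * √(∫ x, (u N x - w x)^2 ∂nuI)) atTop (𝓝 0) := by
        have := (hL2.sqrt).const_mul (√C)
        simpa using this
      refine squeeze_zero_norm (fun N => ?_) hs
      rw [Real.norm_eq_abs]
      refine (cs (hfu N) ((hu N).sub hw).memI).trans ?_
      exact mul_le_mul (Real.sqrt_le_sqrt (hfC N)) le_rfl (Real.sqrt_nonneg _) (Real.sqrt_nonneg _)
    have h2 := h1.add (hW2 w hw)
    rw [zero_add] at h2
    refine lt_of_lt_of_le hρK (ge_of_tendsto' h2 fun N => (hq N).trans (le_of_eq ?_))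
    rw [← integral_add (imul (hfu N) ((hu N).sub hw).memI) (imul (hfu N) hw.memI)]
    congr 1; ext x; simp; ring

lemma final (hω0 : 0 < ω) (hTM : TMprop ω) (hf : HypH f) (hodd : ∀ t : ℝ, f (-t) = -f t) :
    ∃ u : ℕ → ℝ → ℝ, (∀ n, IsWeakSolution f (u n)) ∧
      ∀ m n : ℕ, m ≠ n → ¬ (u m =ᵐ[volume] u n) := by
  choose s hs hsK using exists_sol hω0 hTM hf hodd
  let q : (ℝ → ℝ) → ℝ := fun w => ∫ x, f (w x) * w x ∂nuI
  let K : ℕ → ℝ := fun n => Nat.rec (0:ℝ) (fun _ k => q (s k)) n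
  have hK : StrictMono K := strictMono_nat_of_lt_succ fun n => hsK (K n)
  refine ⟨fun n => s (K n), fun n => hs _, fun m n hmn h => hmn ?_⟩
  have h1 : q (s (K m)) = q (s (K n)) := by
    apply integral_congr_ae
    filter_upwards [ae_restrict_of_ae h] with x hx
    rw [hx]
  have h2 : K (m+1) = K (n+1) := h1
  have := hK.injective (a₁ := m+1) (a₂ := n+1) h2
  omega
end BU

/-- infinitely many solutions for odd `f` (Theorem 1, multiplicity part). -/
theorem statement1 (ω : ℝ) (hω0 : 0 < ω) (hωπ : ω ≤ π) (hTM : TMprop ω)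
    (f : ℝ → ℝ) (hf : HypH f) (hodd : ∀ t : ℝ, f (-t) = -f t) :
    ∃ u : ℕ → ℝ → ℝ, (∀ n, IsWeakSolution f (u n)) ∧
      ∀ m n : ℕ, m ≠ n → ¬ (u m =ᵐ[volume] u n) := by
  exact BU.final hω0 hTM hf hodd
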